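/- arXiv:2310.00214 — 10 statements merged into one kernel-verified Lean document; each statement's English description precedes it below -/
import Mathlib

section
/- Let q be a prime power and let A be a t×n matrix over F_q with 1 ≤ t < n < q+1. For 1 ≤ i ≤ n let A_i be the t×(n−1) matrix obtained from A by deleting its i-th column. If rank(A) = rank(A_1) = … = rank(A_n), then the linear system A uᵀ = 0ᵀ has a solution u = (u_1,…,u_n) all of whose entries u_i are nonzero elements of F_q. -/
/-- The `t × (n-1)` matrix obtained from a `t × n` matrix by deleting its `i`-th column. -/
def deleteCol {F : Type*} {t n : ℕ} (A : Matrix (Fin t) (Fin n) F) (i : Fin n) :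
    Matrix (Fin t) (Fin (n - 1)) F :=
  fun r j =>
    if (j : ℕ) < (i : ℕ) then
      A r ⟨(j : ℕ), by have := j.isLt; have := i.isLt; omega⟩
    else
      A r ⟨(j : ℕ) + 1, by have := j.isLt; have := i.isLt; omega⟩

/-- Over a field with at least `#s` elements, linear forms indexed by `s`, none of which vanishes
identically, are simultaneously nonzero at some vector. -/
theorem exists_forall_apply_ne_zero_of_card_le {F V ι : Type*} [Field F] [Fintype F]
    [AddCommGroup V] [Module F V] (f : ι → V →ₗ[F] F) (s : Finset ι)
    (hcard : s.card ≤ Fintype.card F) (hf : ∀ i ∈ s, ∃ w, f i w ≠ 0) :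
    ∃ v, ∀ i ∈ s, f i v ≠ 0 := by
  classical
  induction s using Finset.induction_on with
  | empty => exact ⟨0, by simp⟩
  | insert i s hi ih =>
    rw [Finset.card_insert_of_notMem hi] at hcard
    obtain ⟨v, hv⟩ := ih (by omega) fun j hj => hf j (Finset.mem_insert_of_mem hj)
    obtain ⟨w, hw⟩ := hf i (Finset.mem_insert_self i s)
    by_cases hiv : f i v = 0
    · obtain ⟨c, hc⟩ : ∃ c : F, c ∉ s.image fun j => -f j w / f j v := by
        by_contra! h
        have h1 : Finset.univ ⊆ s.image fun j => -f j w / f j v := fun c _ => h c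
        have h2 := (Finset.card_le_card h1).trans Finset.card_image_le
        rw [Finset.card_univ] at h2
        omega
      refine ⟨c • v + w, fun j hj => ?_⟩
      rcases Finset.mem_insert.1 hj with rfl | hj
      · simpa [hiv] using hw
      · intro h0
        refine hc (Finset.mem_image.2 ⟨j, hj, ?_⟩)
        rw [map_add, map_smul, smul_eq_mul] at h0
        rw [div_eq_iff (hv j hj)]
        linear_combination -h0
    · refine ⟨v, fun j hj => ?_⟩
      rcases Finset.mem_insert.1 hj with rfl | hj
      · exact hiv
      · exact hv j hj

/-- If removing the `i`-th column does not change the rank, then some kernel vector has a nonzero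
`i`-th entry. -/
theorem exists_kernel_vector_apply_ne_zero_of_rank_deleteCol {F : Type*} [Field F] {t n : ℕ}
    (A : Matrix (Fin t) (Fin n) F) (i : Fin n) (h : (deleteCol A i).rank = A.rank) :
    ∃ w : Fin n → F, A.mulVec w = 0 ∧ w i ≠ 0 := by
  obtain ⟨f, hfi, hf⟩ : ∃ f : Fin (n - 1) → Fin n, (∀ j, f j ≠ i) ∧
      ∀ r j, deleteCol A i r j = A r (f j) := by
    refine ⟨fun j => if (j : ℕ) < i then ⟨j, by omega⟩ else ⟨j + 1, by omega⟩, fun j => ?_,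
      fun r j => ?_⟩
    · dsimp only
      split_ifs <;> simp only [ne_eq, Fin.ext_iff] <;> omega
    · simp only [deleteCol]
      split_ifs <;> rfl
  have hmul (v : Fin (n - 1) → F) :
      (deleteCol A i).mulVec v = A.mulVec (∑ j, Pi.single (f j) (v j)) := by
    rw [Matrix.mulVec_sum]
    ext r
    simp [Matrix.mulVec, dotProduct, hf, mul_comm]
  have hle : LinearMap.range (deleteCol A i).mulVecLin ≤ LinearMap.range A.mulVecLin := by
    rintro _ ⟨v, rfl⟩
    exact ⟨_, (hmul v).symm⟩
  have heq := Submodule.eq_of_le_of_finrank_eq hle h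
  obtain ⟨v, hv⟩ : A.mulVecLin (Pi.single i 1) ∈ LinearMap.range (deleteCol A i).mulVecLin :=
    heq ▸ LinearMap.mem_range_self _ _
  rw [Matrix.mulVecLin_apply, Matrix.mulVecLin_apply, hmul] at hv
  refine ⟨Pi.single i 1 - ∑ j, Pi.single (f j) (v j), ?_, ?_⟩
  · rw [Matrix.mulVec_sub, hv, sub_self]
  · simp [Finset.sum_apply, (hfi _).symm]

theorem exists_nowhere_zero_kernel_vector_of_rank_deleteCol
    (q : ℕ) (hq : IsPrimePow q)
    (F : Type*) [Field F] [Fintype F] (hF : Fintype.card F = q)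
    (t n : ℕ) (ht : 1 ≤ t) (htn : t < n) (hnq : n < q + 1)
    (A : Matrix (Fin t) (Fin n) F)
    (hrank : ∀ i : Fin n, (deleteCol A i).rank = A.rank) :
    ∃ u : Fin n → F, (∀ l, u l ≠ 0) ∧ A.mulVec u = 0 := by
  obtain ⟨u, hu⟩ := exists_forall_apply_ne_zero_of_card_le
    (fun i => (LinearMap.proj i : (Fin n → F) →ₗ[F] F) ∘ₗ (LinearMap.ker A.mulVecLin).subtype)
    Finset.univ (by rw [Finset.card_univ, Fintype.card_fin]; omega) fun i _ => by
      obtain ⟨w, hw, hwi⟩ := exists_kernel_vector_apply_ne_zero_of_rank_deleteCol A i (hrank i)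
      exact ⟨⟨w, hw⟩, hwi⟩
  exact ⟨u, fun l => hu l (Finset.mem_univ l), u.2⟩
end

section
/- Let q be a prime power and let A be a t×n matrix over F_{q^2} with 1 ≤ t ≤ n < q+1. Suppose that (1) the system A uᵀ = 0ᵀ has a solution u = (u_1,…,u_n) with all entries nonzero elements of F_{q^2}, and (2) the matrix A^{(q)} obtained from A by raising every entry to the q-th power is row equivalent to A. Then A uᵀ = 0ᵀ has a solution u = (u_1,…,u_n) all of whose entries are nonzero elements of the subfield F_q of F_{q^2}. -/
open Polynomial in
/-- If at most `q` nonzero elements `u l` of a finite field of size `q ^ 2` are given, some scalar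
`c` makes all the traces `c * u l + (c * u l) ^ q` nonzero. -/
lemma exists_scalar_trace_ne_zero {F ι : Type*} [Field F] [Fintype F] [Fintype ι] {q : ℕ}
    (hq : 1 < q) (hF : Fintype.card F = q ^ 2) (hι : Fintype.card ι ≤ q)
    (u : ι → F) (hu : ∀ l, u l ≠ 0) :
    ∃ c : F, ∀ l, c * u l + (c * u l) ^ q ≠ 0 := by
  obtain ⟨m, rfl⟩ : ∃ m, q = m + 1 := ⟨q - 1, by omega⟩
  let P : F[X] := X * ∏ l, (C (u l ^ (m + 1)) * X ^ m + C (u l))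
  have hfactor (l : ι) : C (u l ^ (m + 1)) * X ^ m + C (u l) ≠ 0 := fun h => by
    have h' := congrArg (eval 0) h
    rw [eval_add, eval_mul, eval_pow, eval_C, eval_C, eval_X, zero_pow (by omega)] at h'
    exact hu l (by simpa using h')
  have hP : P ≠ 0 := mul_ne_zero X_ne_zero (Finset.prod_ne_zero_iff.2 fun l _ => hfactor l)
  have hdeg : P.natDegree ≤ 1 + Fintype.card ι * m := by
    refine natDegree_mul_le.trans (add_le_add natDegree_X_le ?_)
    refine (natDegree_prod_le _ _).trans ?_
    refine (Finset.sum_le_card_nsmul _ _ m fun l _ => ?_).trans (by simp)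
    exact (natDegree_add_C).trans_le (natDegree_C_mul_X_pow_le _ _)
  have hlt : P.natDegree < Fintype.card F := by
    rw [hF]
    nlinarith [Nat.mul_le_mul_right m hι]
  obtain ⟨c, hc⟩ : ∃ c, P.eval c ≠ 0 := by
    by_contra! h
    exact hP (eq_zero_of_natDegree_lt_card_of_eval_eq_zero P Function.injective_id h hlt)
  refine ⟨c, fun l hl => hc ?_⟩
  have hroot : c * (u l ^ (m + 1) * c ^ m + u l) = 0 := by
    rw [← hl]; ring
  rw [eval_mul, eval_X, eval_prod, mul_eq_zero]
  refine (mul_eq_zero.1 hroot).imp_right fun h => ?_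
  exact Finset.prod_eq_zero (Finset.mem_univ l) (by simpa using h)

/-- The kernel of a matrix that is row equivalent to its Frobenius twist is Frobenius stable. -/
lemma mulVec_pow_eq_zero {F ι κ : Type*} [Field F] [Fintype ι] [Fintype κ] [DecidableEq κ]
    {p k : ℕ} [ExpChar F p] {A : Matrix κ ι F} {M : Matrix κ κ F} (hM : IsUnit M)
    (hA : A.map (fun x => x ^ p ^ k) = M * A) {v : ι → F} (hv : A.mulVec v = 0) :
    A.mulVec (fun l => v l ^ p ^ k) = 0 := by
  refine Matrix.mulVec_injective_of_isUnit hM ?_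
  rw [Matrix.mulVec_mulVec, ← hA, Matrix.mulVec_zero]
  ext i
  have hi : ∑ l, A i l * v l = 0 := congrFun hv i
  simp only [Matrix.mulVec, dotProduct, Matrix.map_apply, Pi.zero_apply, ← mul_pow]
  rw [← sum_pow_char_pow, hi, zero_pow (pow_ne_zero _ (expChar_pos F p).ne')]


theorem exists_subfield_nowhere_zero_kernel_vector
    (q : ℕ) (hq : IsPrimePow q)
    (F : Type*) [Field F] [Fintype F] (hF : Fintype.card F = q ^ 2)
    (t n : ℕ) (ht : 1 ≤ t) (htn : t ≤ n) (hnq : n < q + 1)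
    (A : Matrix (Fin t) (Fin n) F)
    -- (1): `A uᵀ = 0` has a solution with all entries nonzero in `F_{q^2}`
    (h1 : ∃ u : Fin n → F, (∀ l, u l ≠ 0) ∧ A.mulVec u = 0)
    -- (2): the entrywise `q`-th power matrix `A^{(q)}` is row equivalent to `A`
    (h2 : ∃ M : Matrix (Fin t) (Fin t) F, IsUnit M ∧
      A.map (fun x => x ^ q) = M * A) :
    -- conclusion: a solution with all entries nonzero and lying in the subfield `F_q`
    -- (the fixed field of the `q`-th power Frobenius)
    ∃ u : Fin n → F, (∀ l, u l ≠ 0 ∧ u l ^ q = u l) ∧ A.mulVec u = 0 := by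
  obtain ⟨u, hu, hAu⟩ := h1
  obtain ⟨M, hM, hMA⟩ := h2
  obtain ⟨p, hp⟩ := CharP.exists F
  obtain ⟨r, hpp, hcard⟩ := FiniteField.card F p
  obtain ⟨k, -, rfl⟩ := (Nat.dvd_prime_pow hpp).1
    (show q ∣ p ^ (r : ℕ) from hcard ▸ hF ▸ dvd_pow_self q two_ne_zero)
  have : ExpChar F p := ExpChar.prime hpp
  obtain ⟨c, hc⟩ := exists_scalar_trace_ne_zero hq.one_lt hF (by simpa using Nat.le_of_lt_succ hnq) u hu
  have hcu : A.mulVec (c • u) = 0 := by rw [Matrix.mulVec_smul, hAu, smul_zero]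
  refine ⟨c • u + fun l => (c • u) l ^ p ^ k, fun l => ⟨hc l, ?_⟩, ?_⟩
  · rw [Pi.add_apply, add_pow_expChar_pow, ← pow_mul, ← sq, ← hF, FiniteField.pow_card, add_comm]
  · rw [Matrix.mulVec_add, hcu, mulVec_pow_eq_zero hM hMA hcu, add_zero]
end

section
/- Let q be an odd prime power, h an even positive integer with (q−1)/h = 2τ+1 for some integer τ ≥ 1, and m = (q^2−1)/(2h). Let t be an integer with 0 ≤ t ≤ h/2 − 1 and let k be an integer with 1 ≤ k and 2hk ≤ (h+2t+1)(q−1) + h. Then for all integers i, j, s with 0 ≤ i, j ≤ k−1 and s ≥ 0, if q·i + j = s·m, then either s = 0, or s is odd with 1 ≤ s ≤ 2t−1, or s is odd with h+1 ≤ s ≤ h+2t−1, or s is even with 2 ≤ s ≤ h+2t (the ranges being empty when their lower bound exceeds their upper bound). -/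
theorem lemma_qminus_plus_one
    (q h τ m : ℕ) (hq : IsPrimePow q) (hqo : Odd q)
    (hh : 0 < h) (hhe : Even h) (hτ : 1 ≤ τ)
    (hdiv : q - 1 = h * (2 * τ + 1))
    (hm : 2 * h * m = q ^ 2 - 1)
    (t k : ℕ) (htlt : 2 * t + 2 ≤ h)  -- i.e. 0 ≤ t ≤ h/2 - 1
    (hk1 : 1 ≤ k)
    (hk : 2 * h * k ≤ (h + 2 * t + 1) * (q - 1) + h)  -- i.e. k ≤ (h+2t+1)(q-1)/(2h) + 1/2
    (i j s : ℕ) (hi : i < k) (hj : j < k)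
    (hij : q * i + j = s * m) :
    s = 0 ∨
    (Odd s ∧ 1 ≤ s ∧ s ≤ 2 * t - 1) ∨
    (Odd s ∧ h + 1 ≤ s ∧ s ≤ h + 2 * t - 1) ∨
    (Even s ∧ 2 ≤ s ∧ s ≤ h + 2 * t) := by
  obtain ⟨g, rfl⟩ := hhe
  obtain ⟨n, hn⟩ : ∃ n, n = 2 * τ + 1 := ⟨_, rfl⟩
  rw [← hn] at hdiv
  have hqn : q = 2 * g * n + 1 := by
    have := hq.pos
    have : q = (g + g) * n + 1 := by omega
    rw [this]; ring
  have hmn : m = n * (g * n + 1) := by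
    have h1 : 2 * (g + g) * m + 1 = q ^ 2 := by
      have : 0 < q ^ 2 := pow_pos hq.pos 2
      omega
    subst hqn
    refine Nat.eq_of_mul_eq_mul_left (by omega : 0 < 2 * (g + g)) ?_
    linarith
  -- the bound on `k` with the factor `h` cancelled
  have hk2 : 2 * k ≤ (2 * g + 2 * t + 1) * n + 1 := by
    rw [hdiv] at hk
    refine Nat.le_of_mul_le_mul_left (?_ : (g + g) * _ ≤ (g + g) * _) hh
    linarith
  have hsn : s * n ≤ 2 * (k - 1) := by
    have hmq : 2 * m = n * (q + 1) := by rw [hmn, hqn]; ring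
    refine Nat.le_of_mul_le_mul_right (?_ : _ * (q + 1) ≤ _ * (q + 1)) (by omega)
    calc s * n * (q + 1) = 2 * (q * i + j) := by rw [hij, mul_assoc, ← hmq]; ring
      _ ≤ 2 * (q * (k - 1) + (k - 1)) := by gcongr <;> omega
      _ = 2 * (k - 1) * (q + 1) := by ring
  have hs : s < 2 * g + 2 * t + 1 :=
    Nat.lt_of_mul_lt_mul_right (show s * n < (2 * g + 2 * t + 1) * n by omega)
  rcases Nat.even_or_odd s with he | ho
  · by_cases h0 : s = 0
    · exact Or.inl h0
    · obtain ⟨u, rfl⟩ := he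
      exact Or.inr (Or.inr (Or.inr ⟨⟨u, rfl⟩, by omega, by omega⟩))
  have ho' := ho
  obtain ⟨u, rfl⟩ := ho'
  by_cases hlarge : 2 * g + 1 ≤ 2 * u + 1
  · exact Or.inr (Or.inr (Or.inl ⟨ho, by omega, by omega⟩))
  -- below `h` the base-`q` digits of `s * m` are `u * n + τ` and `u * n + τ + g * n + 1`
  have hug : (u + 1) * n ≤ g * n := Nat.mul_le_mul_right n (by omega)
  have hjq : j < q := by
    have : (2 * g + 2 * t + 1) * n ≤ (4 * g) * n := Nat.mul_le_mul_right n (by omega)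
    linarith
  have hexp : q * i + j = q * (u * n + τ) + (u * n + τ + g * n + 1) := by
    rw [hij, hmn, hqn, hn]; ring
  have hbq : u * n + τ + g * n + 1 < q := by linarith
  have hjb : j = u * n + τ + g * n + 1 := by
    have := congrArg (· % q) hexp
    simpa only [Nat.mul_add_mod, Nat.mod_eq_of_lt hjq, Nat.mod_eq_of_lt hbq] using this
  have hst : 2 * u + 1 < 2 * t + 1 := by
    refine Nat.lt_of_mul_lt_mul_right (?_ : _ * n < _ * n)
    linarith
  exact Or.inr (Or.inl ⟨ho, by omega, by omega⟩)
end

section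
/- Let q be an odd prime power, h an even positive integer with (q−1)/h = 2τ+1 for some integer τ ≥ 1, let r be an integer with h/2 + 1 ≤ r ≤ h, set n = r(q^2−1)/(2h) + 1, and let k be an integer with 1 ≤ k and 2hk ≤ (h+1)(q−1) + h. Then there exist pairwise distinct elements a_1,…,a_n of F_{q^2} and nonzero elements v_1,…,v_n of F_{q^2} such that Σ_{l=1}^n v_l^{q+1} a_l^{q·i+j} = 0 for all integers 0 ≤ i, j ≤ k−1 (with the convention 0^0 = 1); that is, the generalized Reed–Solomon code GRS_k(a,v) is a Hermitian self-orthogonal [n, k, n−k+1] MDS code over F_{q^2}, which by the Hermitian construction yields an [[n, n−2k, k+1]]_q quantum MDS code. -/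
open Finset

theorem Lagrange.sum_nodalWeight_mul_pow_eq_zero {F ι : Type*} [Field F] [DecidableEq ι]
    {s : Finset ι} {x : ι → F} (hx : Set.InjOn x s) {e : ℕ} (he : e + 1 < #s) :
    ∑ i ∈ s, Lagrange.nodalWeight s x i * x i ^ e = 0 := by
  have hdeg : (Polynomial.X ^ e : Polynomial F).degree < #s := by
    rw [Polynomial.degree_X_pow]
    exact_mod_cast (by omega : e < #s)
  have h := Lagrange.coeff_eq_sum hx hdeg
  rw [Polynomial.coeff_X_pow, if_neg (by omega)] at h
  rw [h]
  refine sum_congr rfl fun i _ => ?_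
  rw [Lagrange.nodalWeight, prod_inv_distrib, Polynomial.eval_pow, Polynomial.eval_X,
    div_eq_mul_inv, mul_comm]

/-- The map `x ↦ x ^ q` on a field with `q ^ 2` elements is a ring homomorphism. -/
theorem FiniteField.exists_ringHom_eq_pow {F : Type*} [Field F] [Fintype F] {q : ℕ}
    (hF : Fintype.card F = q ^ 2) : ∃ φ : F →+* F, ∀ x, φ x = x ^ q := by
  obtain ⟨p, hc, f, hp, hpf⟩ := FiniteField.card' F
  have : Fact p.Prime := ⟨hp⟩
  obtain ⟨g, -, hg⟩ := (Nat.dvd_prime_pow hp).1 (⟨q, by rw [← hpf, hF, sq]⟩ : q ∣ p ^ (f : ℕ))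
  exact ⟨iterateFrobenius F p g, fun x => by rw [iterateFrobenius_def, hg]⟩

theorem FiniteField.exists_isPrimitiveRoot (F : Type*) [Field F] [Fintype F] :
    ∃ θ : F, IsPrimitiveRoot θ (Fintype.card F - 1) := by
  classical
  obtain ⟨u, hu⟩ := IsCyclic.exists_ofOrder_eq_natCard (α := Fˣ)
  refine ⟨u, ?_⟩
  rw [← Fintype.card_units, ← Nat.card_eq_fintype_card, ← hu]
  exact IsPrimitiveRoot.coe_units_iff.2 (IsPrimitiveRoot.orderOf u)

/-- The norm map onto the subfield of order `q` is surjective. -/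
theorem FiniteField.exists_pow_succ_eq {F : Type*} [Field F] [Fintype F] {q : ℕ}
    (hq : 1 < q) (hF : Fintype.card F = q ^ 2) {c : F} (hc : c ≠ 0) (hcq : c ^ q = c) :
    ∃ v : F, v ≠ 0 ∧ v ^ (q + 1) = c := by
  obtain ⟨θ, hθ⟩ := FiniteField.exists_isPrimitiveRoot F
  have hfac : Fintype.card F - 1 = (q + 1) * (q - 1) := by
    rw [hF]
    exact Nat.sq_sub_sq q 1
  have hc1 : c ^ (q - 1) = 1 := by
    apply mul_right_cancel₀ hc
    rw [← pow_succ, Nat.sub_add_cancel hq.le, hcq, one_mul]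
  have : NeZero (Fintype.card F - 1) :=
    ⟨by rw [hfac]; exact Nat.mul_ne_zero (by omega) (by omega)⟩
  obtain ⟨i, -, hi⟩ := hθ.eq_pow_of_pow_eq_one (FiniteField.pow_card_sub_one_eq_one c hc)
  have hdvd : (q + 1) * (q - 1) ∣ i * (q - 1) := by
    rw [← hfac]
    apply hθ.dvd_of_pow_eq_one
    rw [pow_mul, hi, hc1]
  obtain ⟨j, rfl⟩ := Nat.dvd_of_mul_dvd_mul_right (by omega) hdvd
  refine ⟨θ ^ j, fun h => hc ?_, ?_⟩
  · rw [← hi, mul_comm, pow_mul, h, zero_pow (by omega)]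
  · rw [← hi, ← pow_mul, mul_comm]

theorem IsPrimitiveRoot.sum_pow_mul_eq_ite {F : Type*} [Field F] {m : ℕ} {ω : F}
    (hω : IsPrimitiveRoot ω m) (N : ℕ) :
    ∑ t : Fin m, ω ^ ((t : ℕ) * N) = if m ∣ N then (m : F) else 0 := by
  have hpow : ∀ t : Fin m, ω ^ ((t : ℕ) * N) = (ω ^ N) ^ (t : ℕ) := fun t => by
    rw [← pow_mul, mul_comm]
  simp_rw [hpow]
  rw [Fin.sum_univ_eq_sum_range (fun t => (ω ^ N) ^ t) m]
  split_ifs with h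
  · simp [(hω.pow_eq_one_iff_dvd N).2 h]
  · have hne : ω ^ N ≠ 1 := mt (hω.pow_eq_one_iff_dvd N).1 h
    rw [geom_sum_eq hne, ← pow_mul, mul_comm, pow_mul, hω.pow_eq_one, one_pow, sub_self,
      zero_div]

/-- With `M = (q + 1) / 2` and `T = 2 * τ + 1`, the Hermitian exponents `q * i + j` divisible by
`T * M` are the multiples `2 * (T * M) * e` with `e` at most `g = (q - 1) / (2 * T)`. -/
theorem exists_eq_two_mul_of_dvd_hermitian_exponent {τ g M i j : ℕ}
    (hM : M = g * (2 * τ + 1) + 1) (hg : 0 < g)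
    (hi : i ≤ g * (2 * τ + 1) + τ) (hj : j ≤ g * (2 * τ + 1) + τ)
    (hdvd : (2 * τ + 1) * M ∣ (2 * M - 1) * i + j) :
    ∃ e ≤ g, (2 * M - 1) * i + j = 2 * ((2 * τ + 1) * M) * e := by
  have hle : 2 * τ + 1 ≤ g * (2 * τ + 1) := Nat.le_mul_of_pos_left _ hg
  obtain ⟨c, hc⟩ := hdvd
  have hcZ : (2 * (M : ℤ) - 1) * i + j = (2 * τ + 1) * M * c := by
    have : ((2 * M - 1 : ℕ) : ℤ) = 2 * (M : ℤ) - 1 := by omega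
    rw [← this]
    exact_mod_cast hc
  obtain ⟨d, hd⟩ : (M : ℤ) ∣ j - i :=
    ⟨(2 * τ + 1) * c - 2 * i, by linear_combination hcZ⟩
  have hMZ : (M : ℤ) = g * (2 * τ + 1) + 1 := by exact_mod_cast hM
  have hMpos : (0 : ℤ) < M := by omega
  have hd1 : d < 2 := by
    by_contra! h
    have : (M : ℤ) * 2 ≤ M * d := mul_le_mul_of_nonneg_left h hMpos.le
    omega
  have hd2 : -2 < d := by
    by_contra! h
    have : (M : ℤ) * d ≤ M * (-2) := mul_le_mul_of_nonneg_left h hMpos.le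
    omega
  have hid : 2 * (i : ℤ) + d = (2 * τ + 1) * c := by
    apply mul_left_cancel₀ hMpos.ne'
    linear_combination hcZ - hd
  obtain rfl | rfl | rfl : d = -1 ∨ d = 0 ∨ d = 1 := by omega
  · exfalso
    have hdv : (2 * (τ : ℤ) + 1) ∣ 2 * j + 1 :=
      ⟨c - 2 * g, by linear_combination hid + 2 * hd - 2 * hMZ⟩
    have := Int.le_of_dvd (by omega) hdv
    omega
  · have hcop : IsCoprime (2 * (τ : ℤ) + 1) 2 := ⟨1, -τ, by ring⟩
    obtain ⟨e, he⟩ := hcop.dvd_of_dvd_mul_left (⟨c, by linear_combination hid⟩ :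
      (2 * (τ : ℤ) + 1) ∣ 2 * i)
    have he0 : 0 ≤ e := by
      by_contra! h
      nlinarith
    lift e to ℕ using he0
    refine ⟨e, ?_, ?_⟩
    · by_contra! h
      have : (g + 1) * (2 * τ + 1) ≤ e * (2 * τ + 1) := Nat.mul_le_mul_right _ h
      have : i = e * (2 * τ + 1) := by
        rw [mul_comm]; exact_mod_cast he
      linarith
    · have hce : c = 2 * e := by
        have : (2 * (τ : ℤ) + 1) * c = (2 * τ + 1) * (2 * e) := by
          linear_combination 2 * he - hid
        exact_mod_cast mul_left_cancel₀ (by omega) this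
      rw [hc, hce]
      ring
  · exfalso
    have := Int.le_of_dvd (by omega) (⟨c, hid⟩ : (2 * (τ : ℤ) + 1) ∣ 2 * i + 1)
    omega

theorem thm_qminus_len_plus_one_case1
    (q h τ r n : ℕ) (hq : IsPrimePow q) (hqo : Odd q)
    (hh : 0 < h) (hhe : Even h) (hτ : 1 ≤ τ)
    (hdiv : q - 1 = h * (2 * τ + 1))
    (hr1 : h + 2 ≤ 2 * r) (hr2 : r ≤ h)  -- i.e. h/2 + 1 ≤ r ≤ h
    -- n = r(q²-1)/(2h) + 1
    (hn : 2 * h * n = r * (q ^ 2 - 1) + 2 * h)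
    (k : ℕ) (hk1 : 1 ≤ k)
    -- k ≤ (h+1)(q-1)/(2h) + 1/2
    (hk : 2 * h * k ≤ (h + 1) * (q - 1) + h)
    (F : Type*) [Field F] [Fintype F] (hF : Fintype.card F = q ^ 2) :
    ∃ a v : Fin n → F, Function.Injective a ∧ (∀ l, v l ≠ 0) ∧
      ∀ i j : ℕ, i < k → j < k →
        ∑ l, v l ^ (q + 1) * a l ^ (q * i + j) = 0 := by
  classical
  have hq1 : 1 < q := hq.one_lt
  obtain ⟨g, hg⟩ := hhe
  have hgh : h = 2 * g := by omega
  clear hg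
  subst hgh
  have hg0 : 0 < g := by omega
  obtain ⟨M, hM⟩ : ∃ M, M = g * (2 * τ + 1) + 1 := ⟨_, rfl⟩
  have hqM : q = 2 * M - 1 := by
    have : 2 * g * (2 * τ + 1) = 2 * (g * (2 * τ + 1)) := by ring
    omega
  obtain ⟨m, hm⟩ : ∃ m, m = (2 * τ + 1) * M := ⟨_, rfl⟩
  have hm0 : 0 < m := by rw [hm]; exact Nat.mul_pos (by omega) (by omega)
  have hcard : q ^ 2 - 1 = 2 * (2 * g) * m := by
    rw [(Nat.sq_sub_sq q 1 : q ^ 2 - 1 = _), hdiv, hm, (by omega : q + 1 = 2 * M)]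
    ring
  have hn' : n = r * m + 1 := by
    apply Nat.eq_of_mul_eq_mul_left (by omega : 0 < 2 * (2 * g))
    rw [hn, hcard]
    ring
  have hkb : k ≤ g * (2 * τ + 1) + τ + 1 := by
    apply Nat.le_of_mul_le_mul_left _ (by omega : 0 < 2 * (2 * g))
    refine hk.trans (le_of_eq ?_)
    rw [hdiv]
    ring
  obtain ⟨φ, hφ⟩ := FiniteField.exists_ringHom_eq_pow hF
  obtain ⟨θ, hθ⟩ := FiniteField.exists_isPrimitiveRoot F
  rw [hF, hcard] at hθ
  have hord0 : 0 < 2 * (2 * g) * m := Nat.mul_pos (by omega) hm0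
  have hω : IsPrimitiveRoot (θ ^ (2 * (2 * g))) m := hθ.pow hord0 rfl
  have hζ : IsPrimitiveRoot (θ ^ (2 * m)) (2 * g) := hθ.pow hord0 (by ring)
  have hθ0 : θ ≠ 0 := hθ.ne_zero hord0.ne'
  have hmF : (m : F) ≠ 0 := by
    intro h0
    have h1 : ((q ^ 2 - 1 + 1 : ℕ) : F) = 0 := by
      rw [Nat.sub_add_cancel (Nat.one_le_pow _ _ (by omega)), ← hF]
      exact Nat.cast_card_eq_zero F
    rw [hcard] at h1
    push_cast at h1
    simp [h0] at h1
  let x : Option (Fin r) → F := fun o => o.elim 0 fun s => (θ ^ (2 * m)) ^ (s : ℕ)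
  have hxinj : Function.Injective x := by
    rintro (_ | s) (_ | t) hst
    · rfl
    · exact absurd hst.symm (pow_ne_zero _ (pow_ne_zero _ hθ0))
    · exact absurd hst (pow_ne_zero _ (pow_ne_zero _ hθ0))
    · exact congrArg some (Fin.ext (hζ.pow_inj (by omega) (by omega) hst))
  have hxφ : ∀ o, φ (x o) = x o := by
    rintro (_ | s)
    · exact map_zero φ
    · have h1 : φ (θ ^ (2 * m)) = θ ^ (2 * m) := by
        rw [hφ, (by omega : q = q - 1 + 1), pow_succ, hdiv, pow_mul, hζ.pow_eq_one, one_pow,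
          one_mul]
      change φ ((θ ^ (2 * m)) ^ (s : ℕ)) = (θ ^ (2 * m)) ^ (s : ℕ)
      rw [map_pow, h1]
  let w : Option (Fin r) → F := Lagrange.nodalWeight univ x
  have hw0 : ∀ o, w o ≠ 0 := fun o => Lagrange.nodalWeight_ne_zero hxinj.injOn (mem_univ o)
  have hwφ : ∀ o, φ (w o) = w o := fun o => by
    simp only [w, Lagrange.nodalWeight, map_prod, map_inv₀, map_sub, hxφ]
  let u : Option (Fin r × Fin m) → F := fun o => o.elim (m * w none) fun st => w (some st.1)
  have hu0 : ∀ o, u o ≠ 0 := by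
    rintro (_ | st)
    · exact mul_ne_zero hmF (hw0 none)
    · exact hw0 _
  have huq : ∀ o, u o ^ q = u o := by
    rintro (_ | st)
    · change (m * w none) ^ q = m * w none
      rw [← hφ, map_mul, map_natCast, hwφ]
    · exact (hφ _).symm.trans (hwφ _)
  choose v hv0 hv using fun o => FiniteField.exists_pow_succ_eq hq1 hF (hu0 o) (huq o)
  let a : Option (Fin r × Fin m) → F := fun o =>
    o.elim 0 fun st => θ ^ ((st.1 : ℕ) + 2 * (2 * g) * (st.2 : ℕ))
  have hainj : Function.Injective a := by
    rintro (_ | ⟨s, t⟩) (_ | ⟨s', t'⟩) hst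
    · rfl
    · exact absurd hst.symm (pow_ne_zero _ hθ0)
    · exact absurd hst (pow_ne_zero _ hθ0)
    · have hlt : ∀ (s : Fin r) (t : Fin m), (s : ℕ) + 2 * (2 * g) * t < 2 * (2 * g) * m := by
        intro s t
        have : 2 * (2 * g) * (t + 1 : ℕ) ≤ 2 * (2 * g) * m := Nat.mul_le_mul_left _ t.2
        rw [mul_add] at this
        omega
      have heq := hθ.pow_inj (hlt s t) (hlt s' t') hst
      have hs : (s : ℕ) = s' := by
        have := congrArg (· % (2 * (2 * g))) heq
        simpa [Nat.add_mul_mod_self_left, Nat.mod_eq_of_lt (by omega : (s : ℕ) < 2 * (2 * g)),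
          Nat.mod_eq_of_lt (by omega : (s' : ℕ) < 2 * (2 * g))] using this
      have ht : (t : ℕ) = t' := by
        rw [hs] at heq
        exact Nat.eq_of_mul_eq_mul_left (by omega) (Nat.add_left_cancel heq)
      rw [Fin.ext hs, Fin.ext ht]
  have hsum : ∀ i j : ℕ, i < k → j < k → ∑ o, u o * a o ^ (q * i + j) = 0 := by
    intro i j hi hj
    have hinner : ∀ (N : ℕ) (s : Fin r), ∑ t : Fin m, u (some (s, t)) * a (some (s, t)) ^ N =
        w (some s) * θ ^ ((s : ℕ) * N) * if m ∣ N then (m : F) else 0 := by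
      intro N s
      rw [← hω.sum_pow_mul_eq_ite, mul_sum]
      refine sum_congr rfl fun t _ => ?_
      change w (some s) * (θ ^ ((s : ℕ) + 2 * (2 * g) * (t : ℕ))) ^ N = _
      ring
    rw [Fintype.sum_option, Fintype.sum_prod_type]
    simp_rw [hinner]
    change m * w none * 0 ^ (q * i + j) + _ = 0
    by_cases hdvd : m ∣ q * i + j
    · obtain ⟨e, heg, he⟩ := exists_eq_two_mul_of_dvd_hermitian_exponent hM hg0
        (by omega : i ≤ _) (by omega : j ≤ _) (by rwa [← hm, ← hqM])
      rw [← hm, ← hqM] at he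
      have hz := Lagrange.sum_nodalWeight_mul_pow_eq_zero (s := univ) hxinj.injOn
        (e := e) (by rw [card_univ, Fintype.card_option, Fintype.card_fin]; omega)
      rw [Fintype.sum_option] at hz
      have hz' := congrArg ((m : F) * ·) hz
      simp only [mul_zero, mul_add, mul_sum] at hz'
      rw [if_pos hdvd, he]
      refine Eq.trans ?_ hz'
      congr 1
      · change _ = (m : F) * (w none * 0 ^ e)
        rw [pow_mul, zero_pow (Nat.mul_ne_zero two_ne_zero hm0.ne'), mul_assoc]
      · refine sum_congr rfl fun s _ => ?_
        change _ = (m : F) * (w (some s) * ((θ ^ (2 * m)) ^ (s : ℕ)) ^ e)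
        ring
    · have hN : q * i + j ≠ 0 := fun h0 => hdvd (h0 ▸ dvd_zero m)
      simp only [hdvd, if_false, mul_zero, sum_const_zero, zero_pow hN, add_zero]
  let E : Fin n ≃ Option (Fin r × Fin m) :=
    (Fintype.equivFinOfCardEq (by simp [hn'])).symm
  refine ⟨a ∘ E, v ∘ E, hainj.comp E.injective, fun l => hv0 _, fun i j hi hj => ?_⟩
  rw [← hsum i j hi hj, ← E.sum_comp]
  simp only [Function.comp_apply, hv]
end

section
/- Let q be an odd prime power, h an even positive integer with (q−1)/h = 2τ+1 for some integer τ ≥ 1, and m = (q^2−1)/(2h). Let t be an integer with 1 ≤ t ≤ h/2 and let k be an integer with 1 ≤ k and 2hk ≤ (h+2t)(q−1). Then for all integers i, j, s with 0 ≤ i, j ≤ k−1 and s ≥ 0, if q·i + j + (q+1)/2 = s·m, then either s is even with 2 ≤ s ≤ 2t−2, or s is even with h+2 ≤ s ≤ h+2t−2, or s is odd with 1 ≤ s ≤ h+2t−1 (the ranges being empty when their lower bound exceeds their upper bound). -/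
theorem lemma_qminus_no_plus_one
    (q h τ m : ℕ) (hq : IsPrimePow q) (hqo : Odd q)
    (hh : 0 < h) (hhe : Even h) (hτ : 1 ≤ τ)
    (hdiv : q - 1 = h * (2 * τ + 1))
    (hm : 2 * h * m = q ^ 2 - 1)
    (t k : ℕ) (ht1 : 1 ≤ t) (hth : 2 * t ≤ h)  -- i.e. 1 ≤ t ≤ h/2
    (hk1 : 1 ≤ k)
    (hk : 2 * h * k ≤ (h + 2 * t) * (q - 1))  -- i.e. k ≤ (h+2t)(q-1)/(2h)
    (i j s : ℕ) (hi : i < k) (hj : j < k)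
    (hij : 2 * (q * i + j) + (q + 1) = 2 * (s * m)) :  -- i.e. qi + j + (q+1)/2 = s m
    (Even s ∧ 2 ≤ s ∧ s ≤ 2 * t - 2) ∨
    (Even s ∧ h + 2 ≤ s ∧ s ≤ h + 2 * t - 2) ∨
    (Odd s ∧ 1 ≤ s ∧ s ≤ h + 2 * t - 1) := by
  obtain ⟨g, rfl⟩ := hhe
  have hg : 0 < g := by omega
  have hq1 : 1 ≤ q := hqo.pos
  obtain ⟨n, hn⟩ : ∃ n, n = 2 * τ + 1 := ⟨_, rfl⟩
  rw [← hn] at hdiv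
  obtain rfl : q = 2 * (g * n) + 1 := by
    have : (g + g) * n = 2 * (g * n) := by ring
    omega
  have hmn : m = n * (g * n + 1) := by
    have hsq : (2 * (g * n) + 1) ^ 2 - 1 = 2 * (g + g) * (n * (g * n + 1)) :=
      Nat.sub_eq_of_eq_add (by ring)
    exact Nat.eq_of_mul_eq_mul_left (by positivity) (hm.trans hsq)
  have hkn : k ≤ (g + t) * n := by
    rw [hdiv] at hk
    refine le_of_mul_le_mul_left (a := 2 * (g + g)) (hk.trans (le_of_eq ?_)) (by positivity)
    ring
  have heq : (2 * (g * n) + 1) * i + j + (g * n + 1) = s * n * (g * n + 1) := by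
    have : s * m = s * n * (g * n + 1) := by rw [hmn]; ring
    omega
  have hs : s < 2 * (g + t) := by
    have hi' : i + 1 ≤ (g + t) * n := by omega
    have hj' : j + 1 ≤ (g + t) * n := by omega
    have h1 : s * n * (g * n + 1) < 2 * (g + t) * n * (g * n + 1) := by
      nlinarith [Nat.mul_le_mul_left (2 * (g * n) + 1) hi']
    exact Nat.lt_of_mul_lt_mul_right (Nat.lt_of_mul_lt_mul_right h1)
  rcases Nat.even_or_odd s with he | ho
  · obtain ⟨a, rfl⟩ := he
    rcases le_or_gt a g with hag | hag
    · have han : a * n ≤ g * n := Nat.mul_le_mul_right n hag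
      have hid : i + 1 = a * n := by
        have hlt : i < a * n := by
          by_contra! hle
          nlinarith [Nat.mul_le_mul_left (2 * (g * n) + 1) hle]
        by_contra hne
        have hi' : i + 2 ≤ a * n := by omega
        have htg : t * n ≤ g * n := Nat.mul_le_mul_right n (by omega)
        nlinarith [Nat.mul_le_mul_left (2 * (g * n) + 1) hi']
      have hjn : j = (g + a) * n := by
        rw [add_mul a a n, ← hid] at heq
        rw [add_mul, ← hid]
        linarith
      have hat : a < t := by
        have : (g + a) * n < (g + t) * n := by omega
        have := Nat.lt_of_mul_lt_mul_right this
        omega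
      have ha : 0 < a := Nat.pos_of_mul_pos_right (by omega : 0 < a * n)
      exact Or.inl ⟨⟨a, rfl⟩, by omega, by omega⟩
    · exact Or.inr (Or.inl ⟨⟨a, rfl⟩, by omega, by omega⟩)
  · exact Or.inr (Or.inr ⟨ho, ho.pos, by omega⟩)
end

section
/- Let q be an odd prime power, h an even positive integer with (q−1)/h = 2τ+1 for some integer τ ≥ 1, let r be an integer with h/2 + 1 < r ≤ h, set n = r(q^2−1)/(2h), and let k be an integer with 1 ≤ k and 2hk ≤ (h+2)(q−1). Then there exist pairwise distinct elements a_1,…,a_n of F_{q^2} and nonzero elements v_1,…,v_n of F_{q^2} such that Σ_{l=1}^n v_l^{q+1} a_l^{q·i+j} = 0 for all integers 0 ≤ i, j ≤ k−1 (with the convention 0^0 = 1); that is, the generalized Reed–Solomon code GRS_k(a,v) is a Hermitian self-orthogonal [n, k, n−k+1] MDS code over F_{q^2}, which by the Hermitian construction yields an [[n, n−2k, k+1]]_q quantum MDS code. -/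
open Finset

section FiniteFieldSums

variable {F : Type*} [Field F] [Fintype F]

theorem exists_primitive_generator (F : Type*) [Field F] [Fintype F] :
    ∃ g : F, IsPrimitiveRoot g (Fintype.card F - 1) ∧ ∀ x : F, x ≠ 0 → ∃ i : ℕ, x = g ^ i := by
  classical
  obtain ⟨u, hu⟩ := IsCyclic.exists_monoid_generator (α := Fˣ)
  refine ⟨u, ?_, fun x hx => ?_⟩
  · have h1 : orderOf u = Fintype.card F - 1 := by
      rw [← Fintype.card_units, ← Nat.card_eq_fintype_card]
      refine orderOf_eq_card_of_forall_mem_zpowers fun x => ?_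
      obtain ⟨k, hk⟩ := hu x
      exact ⟨k, by simpa using hk⟩
    rw [IsPrimitiveRoot.coe_units_iff, ← h1]
    exact IsPrimitiveRoot.orderOf u
  · obtain ⟨i, hi⟩ := hu (Units.mk0 x hx)
    refine ⟨i, ?_⟩
    have := congrArg Units.val hi
    simpa using this.symm

theorem card_filter_pow_eq [DecidableEq F] {d e : ℕ} (hde : d * e = Fintype.card F - 1) {y : F}
    (hy : y ^ e = 1) : #{x : F | x ^ d = y} = d := by
  obtain ⟨g, hg, hgen⟩ := exists_primitive_generator F
  have hpos : 0 < d * e := by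
    have := Fintype.one_lt_card (α := F)
    omega
  have hd : 0 < d := Nat.pos_of_mul_pos_right hpos
  have he : 0 < e := Nat.pos_of_mul_pos_left hpos
  rw [← hde] at hg
  have hy0 : y ≠ 0 := by
    rintro rfl
    rw [zero_pow he.ne'] at hy
    exact zero_ne_one hy
  obtain ⟨i, rfl⟩ := hgen y hy0
  rw [← pow_mul] at hy
  obtain ⟨j, rfl⟩ := Nat.dvd_of_mul_dvd_mul_right he (hg.dvd_of_pow_eq_one _ hy)
  have hprim : IsPrimitiveRoot (g ^ e) d := hg.pow hpos (mul_comm d e)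
  have hcard := hprim.card_nthRoots (g ^ (d * j))
  rw [if_pos ⟨g ^ j, by rw [← pow_mul, mul_comm]⟩] at hcard
  have hnd : (Polynomial.nthRoots d (g ^ (d * j))).Nodup := hprim.nthRoots_nodup hy0
  rw [← Multiset.toFinset_card_of_nodup hnd] at hcard
  refine Eq.trans (congrArg card ?_) hcard
  ext x
  simp [Polynomial.mem_nthRoots hd]

theorem sum_pow_filter_pow_eq_zero [DecidableEq F] {d e E : ℕ} (hde : d * e = Fintype.card F - 1)
    (hE : ¬ d ∣ E) (y : F) : ∑ x : F with x ^ d = y, x ^ E = 0 := by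
  obtain ⟨g, hg, -⟩ := exists_primitive_generator F
  have hpos : 0 < d * e := by
    have := Fintype.one_lt_card (α := F)
    omega
  rw [← hde] at hg
  have hprim : IsPrimitiveRoot (g ^ e) d := hg.pow hpos (mul_comm d e)
  have hd : 0 < d := Nat.pos_of_mul_pos_right hpos
  have hμ0 : g ^ e ≠ 0 := hprim.ne_zero hd.ne'
  have hμ : (g ^ e) ^ E ≠ 1 := fun h => hE (hprim.dvd_of_pow_eq_one _ h)
  generalize g ^ e = μ at *
  have key : ∑ x : F with x ^ d = y, x ^ E = μ ^ E * ∑ x : F with x ^ d = y, x ^ E := by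
    rw [mul_sum]
    symm
    refine sum_equiv (Equiv.mulLeft₀ μ hμ0) (fun x => ?_) (fun x _ => ?_)
    · simp [mul_pow, hprim.pow_eq_one]
    · simp [mul_pow]
  have h2 : (μ ^ E - 1) * ∑ x : F with x ^ d = y, x ^ E = 0 := by
    rw [sub_mul, ← key]; ring
  exact (mul_eq_zero.mp h2).resolve_left (sub_ne_zero.mpr hμ)

theorem sum_pow_div_prod_sub_eq_zero {F : Type*} [Field F] [DecidableEq F] (Y : Finset F)
    {c : ℕ} (hc : c + 1 < #Y) :
    ∑ y ∈ Y, y ^ c / ∏ z ∈ Y.erase y, (y - z) = 0 := by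
  have h := Lagrange.coeff_eq_sum (s := Y) (v := id) Function.injective_id.injOn
    (P := (Polynomial.X : Polynomial F) ^ c) (by
      rw [Polynomial.degree_X_pow]
      exact_mod_cast (by omega : c < #Y))
  rw [Polynomial.coeff_X_pow, if_neg (by omega)] at h
  simpa using h.symm

end FiniteFieldSums

section SquareOrder

variable {F : Type*} [Field F] [Fintype F] {l : ℕ}

theorem exists_frobenius (hq : IsPrimePow (2 * l + 1)) (hF : Fintype.card F = (2 * l + 1) ^ 2) :
    ∃ σ : F →+* F, (∀ x, σ x = x ^ (2 * l + 1)) ∧ ((2 * l + 1 : ℕ) : F) = 0 ∧ (2 : F) ≠ 0 := by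
  obtain ⟨p, e, hp, he, hpe⟩ := (isPrimePow_nat_iff _).mp hq
  obtain ⟨p', hp'⟩ := CharP.exists F
  obtain ⟨n, hprime, hn⟩ := FiniteField.card F p'
  have hpp : p' = p := by
    have h1 : p' ∣ p ^ (e * 2) := by
      rw [pow_mul, hpe, ← hF, hn]
      exact dvd_pow_self _ n.pos.ne'
    exact (Nat.prime_dvd_prime_iff_eq hprime hp).mp (hprime.dvd_of_dvd_pow h1)
  subst hpp
  have : Fact p'.Prime := ⟨hp⟩
  have hz : ((2 * l + 1 : ℕ) : F) = 0 := by
    rw [← hpe, Nat.cast_pow, CharP.cast_eq_zero, zero_pow he.ne']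
  refine ⟨iterateFrobenius F p' e, fun x => ?_, hz, fun h2 => ?_⟩
  · rw [iterateFrobenius_def, hpe]
  · push_cast at hz
    rw [h2] at hz
    simp at hz

theorem card_sub_one {F : Type*} [Fintype F] {l : ℕ} (hF : Fintype.card F = (2 * l + 1) ^ 2) :
    Fintype.card F - 1 = (2 * l + 2) * (2 * l) := by
  rw [hF]
  have : (2 * l + 1) ^ 2 = (2 * l + 2) * (2 * l) + 1 := by ring
  omega

theorem sum_norm_mem_eq_zero [DecidableEq F] {t : ℕ} (hF : Fintype.card F = (2 * l + 1) ^ 2)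
    (hz : ((2 * l + 1 : ℕ) : F) = 0) (ht : t ≤ l) (Y : Finset F) (hY : ∀ y ∈ Y, y ^ l = -1)
    (φ : F → F) (hφ : ∀ c, 1 ≤ c → c ≤ t → ∑ y ∈ Y, φ y * y ^ c = 0) {i j : ℕ}
    (hi : i ≤ l + t) (hj : j ≤ l + t) :
    ∑ x : F with x ^ (2 * l + 2) ∈ Y,
      φ (x ^ (2 * l + 2)) * x ^ (l + 1 + (2 * l + 1) * i + j) = 0 := by
  set E := l + 1 + (2 * l + 1) * i + j with hE
  have hde := (card_sub_one hF).symm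
  have hfib : ∑ x : F with x ^ (2 * l + 2) ∈ Y, φ (x ^ (2 * l + 2)) * x ^ E =
      ∑ y ∈ Y, φ y * ∑ x : F with x ^ (2 * l + 2) = y, x ^ E := by
    rw [← sum_fiberwise_of_maps_to (s := univ.filter fun x : F => x ^ (2 * l + 2) ∈ Y) (t := Y)
      (g := fun x => x ^ (2 * l + 2)) (by simp)]
    refine sum_congr rfl fun y hy => ?_
    rw [mul_sum, filter_filter]
    refine sum_congr ?_ ?_
    · ext x
      simp only [mem_filter, mem_univ, true_and]
      exact ⟨fun h => h.2, fun h => ⟨h ▸ hy, h⟩⟩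
    · intro x hx
      simp only [mem_filter, mem_univ, true_and] at hx
      rw [hx]
  rw [hfib]
  by_cases hdvd : (2 * l + 2) ∣ E
  · have hval : ∀ c, E = (2 * l + 2) * c → ∀ y ∈ Y,
        ∑ x : F with x ^ (2 * l + 2) = y, x ^ E = y ^ c := by
      intro c hc y hy
      have hcard : #{x : F | x ^ (2 * l + 2) = y} = 2 * l + 2 :=
        card_filter_pow_eq hde (by rw [mul_comm, pow_mul, hY y hy]; norm_num)
      rw [sum_congr rfl (g := fun _ => y ^ c), sum_const, hcard, nsmul_eq_mul,
        show ((2 * l + 2 : ℕ) : F) = 1 by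
          rw [show 2 * l + 2 = (2 * l + 1) + 1 by ring, Nat.cast_add, hz]; simp, one_mul]
      intro x hx
      simp only [mem_filter, mem_univ, true_and] at hx
      rw [hc, pow_mul, hx]
    have hsplit : i = j + (l + 1) ∨ j = i + (l + 1) := by
      obtain ⟨c, hc⟩ := hdvd
      have h1 : (l + 1 + j : ℤ) - i = (2 * l + 2) * (c - i) := by
        have : ((l + 1 + (2 * l + 1) * i + j : ℕ) : ℤ) = ((2 * l + 2) * c : ℕ) := by
          rw [← hc]
        push_cast at this
        linarith
      have h2 : (c - i : ℤ) < 2 := by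
        by_contra! h
        nlinarith
      have h3 : (-1 : ℤ) < c - i := by
        by_contra! h
        nlinarith
      have h4 : (c - i : ℤ) = 0 ∨ (c - i : ℤ) = 1 := by omega
      rcases h4 with h4 | h4 <;> rw [h4] at h1 <;> omega
    rcases hsplit with h | h
    · rw [sum_congr rfl fun y hy => by
        rw [hval (j + 1 + l) (by rw [hE, h]; ring) y hy, pow_add, hY y hy,
          show φ y * (y ^ (j + 1) * -1) = -(φ y * y ^ (j + 1)) by ring],
        sum_neg_distrib, hφ _ (by omega) (by omega), neg_zero]
    · rw [sum_congr rfl fun y hy => by rw [hval (i + 1) (by rw [hE, h]; ring) y hy]]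
      exact hφ _ (by omega) (by omega)
  · exact sum_eq_zero fun y _ => by rw [sum_pow_filter_pow_eq_zero hde hdvd, mul_zero]

theorem exists_points_of_weight [DecidableEq F] {n k : ℕ}
    (hF : Fintype.card F = (2 * l + 1) ^ 2) (P : Finset F) (w : F → F)
    (hw : ∀ x ∈ P, w x ≠ 0 → w x ^ (2 * l) = 1) (hn : #{x ∈ P | w x ≠ 0} = n)
    (hsum : ∀ i j : ℕ, i < k → j < k → ∑ x ∈ P, w x * x ^ ((2 * l + 1) * i + j) = 0) :
    ∃ a v : Fin n → F, Function.Injective a ∧ (∀ s, v s ≠ 0) ∧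
      ∀ i j : ℕ, i < k → j < k →
        ∑ s, v s ^ (2 * l + 1 + 1) * a s ^ ((2 * l + 1) * i + j) = 0 := by
  have hroot : ∀ x ∈ {x ∈ P | w x ≠ 0}, ∃ v : F, v ^ (2 * l + 2) = w x := by
    intro x hx
    rw [mem_filter] at hx
    have hcard := card_filter_pow_eq (card_sub_one hF).symm (hw x hx.1 hx.2)
    obtain ⟨v, hv⟩ := card_pos.mp (hcard ▸ (by omega : 0 < 2 * l + 2))
    exact ⟨v, by simpa using hv⟩
  choose! r hr using hroot
  let ε := (equivFinOfCardEq hn).symm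
  refine ⟨fun s => ε s, fun s => r (ε s), Subtype.val_injective.comp ε.injective, ?_, ?_⟩
  · intro s h0
    have h1 := hr _ (ε s).2
    simp only at h0
    rw [h0, zero_pow (by omega)] at h1
    exact (mem_filter.mp (ε s).2).2 h1.symm
  · intro i j hi hj
    rw [ε.sum_comp (fun x : {x ∈ P | w x ≠ 0} =>
      r x ^ (2 * l + 1 + 1) * (x : F) ^ ((2 * l + 1) * i + j)),
      sum_coe_sort {x ∈ P | w x ≠ 0} (fun x => r x ^ (2 * l + 1 + 1) * x ^ ((2 * l + 1) * i + j)),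
      sum_filter]
    refine (sum_congr rfl fun x hx => ?_).trans (hsum i j hi hj)
    split_ifs with h
    · rw [hr x (mem_filter.mpr ⟨hx, h⟩)]
    · rw [not_not.mp h, zero_mul]

theorem card_nonsquare_line [DecidableEq F] (hF : Fintype.card F = (2 * l + 1) ^ 2) {σ : F →+* F}
    (hσ : ∀ x, σ x = x ^ (2 * l + 1)) (h2 : (2 : F) ≠ 0) (hl : 0 < l) {c : F}
    (hc : c ^ (2 * l) = -1) :
    #{x : F | x ^ ((2 * l + 2) * l) = -1 ∧ x - x ^ (2 * l + 1) = c} = l + 1 := by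
  have hne : (1 : F) ≠ -1 := by
    intro h
    apply h2
    linear_combination h
  have hcs := card_sub_one hF
  have hV : #{b : F | b ^ (2 * l) = -1} = 2 * l :=
    card_filter_pow_eq (e := 2 * l + 2) (by rw [hcs, mul_comm])
      (by rw [show 2 * l + 2 = 2 * (l + 1) by ring, pow_mul]; norm_num)
  have hT : #{x : F | x ^ ((2 * l + 2) * l) = -1} = (2 * l + 2) * l :=
    card_filter_pow_eq (e := 2) (by rw [hcs]; ring) (by norm_num)
  have hle : ∀ b b' : F, b ^ (2 * l) = -1 → b' ^ (2 * l) = -1 →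
      #{x : F | x ^ ((2 * l + 2) * l) = -1 ∧ x - x ^ (2 * l + 1) = b} ≤
      #{x : F | x ^ ((2 * l + 2) * l) = -1 ∧ x - x ^ (2 * l + 1) = b'} := by
    intro b b' hb hb'
    have hb0 : b ≠ 0 := by
      rintro rfl
      rw [zero_pow (by omega)] at hb
      simp at hb
    have hb0' : b' ≠ 0 := by
      rintro rfl
      rw [zero_pow (by omega)] at hb'
      simp at hb'
    have hs : (b' / b) ^ (2 * l) = 1 := by
      rw [div_pow, hb, hb', div_self (by simp)]
    have hs0 : b' / b ≠ 0 := div_ne_zero hb0' hb0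
    refine card_le_card_of_injOn (fun x => b' / b * x) ?_ (mul_right_injective₀ hs0).injOn
    intro x hx
    simp only [coe_filter, mem_univ, true_and, Set.mem_ofPred_eq] at hx ⊢
    constructor
    · rw [mul_pow, hx.1, show (2 * l + 2) * l = 2 * l * (l + 1) by ring, pow_mul, hs, one_pow,
        one_mul]
    · rw [mul_pow, pow_succ (b' / b), hs, one_mul, ← mul_sub, hx.2, div_mul_cancel₀ _ hb0]
  have hfib := card_eq_sum_card_fiberwise (s := {x : F | x ^ ((2 * l + 2) * l) = -1})
    (t := {b : F | b ^ (2 * l) = -1}) (f := fun x => x - x ^ (2 * l + 1)) (by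
      intro x hx
      simp only [coe_filter, mem_univ, true_and, Set.mem_ofPred_eq] at hx ⊢
      have hx0 : x - x ^ (2 * l + 1) ≠ 0 := by
        intro h
        have hx1 : x ≠ 0 := by
          rintro rfl
          rw [zero_pow (by positivity)] at hx
          simp at hx
        have h1 : x ^ (2 * l) = 1 := by
          have : x * (1 - x ^ (2 * l)) = 0 := by rw [← h]; ring
          have := (mul_eq_zero.mp this).resolve_left hx1
          linear_combination -this
        rw [show (2 * l + 2) * l = 2 * l * (l + 1) by ring, pow_mul, h1, one_pow] at hx
        exact hne hx
      have hxx : x ^ ((2 * l + 1) * (2 * l + 1)) = x := by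
        rw [← sq, ← hF]
        exact FiniteField.pow_card x
      have hq : (x - x ^ (2 * l + 1)) ^ (2 * l + 1) = -(x - x ^ (2 * l + 1)) := by
        rw [← hσ (x - _), map_sub, hσ, hσ, ← pow_mul, hxx]
        ring
      rw [pow_succ] at hq
      exact mul_right_cancel₀ hx0 (by rw [hq]; ring))
  rw [hT, sum_congr rfl (g := fun _ =>
    #{x : F | x ^ ((2 * l + 2) * l) = -1 ∧ x - x ^ (2 * l + 1) = c}), sum_const, hV,
    smul_eq_mul] at hfib
  · have : 2 * l * (l + 1) = 2 * l *
        #{x : F | x ^ ((2 * l + 2) * l) = -1 ∧ x - x ^ (2 * l + 1) = c} := by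
      rw [← hfib]; ring
    exact (Nat.eq_of_mul_eq_mul_left (by omega) this).symm
  · intro b hb
    simp only [mem_filter, mem_univ, true_and] at hb
    rw [filter_filter]
    exact le_antisymm (hle _ _ hb hc) (hle _ _ hc hb)

theorem two_mul_card_image_norm_line_le [DecidableEq F] (hF : Fintype.card F = (2 * l + 1) ^ 2)
    {σ : F →+* F} (hσ : ∀ x, σ x = x ^ (2 * l + 1)) (h2 : (2 : F) ≠ 0) (hl : 0 < l) {c : F}
    (hc : c ^ (2 * l) = -1) :
    2 * #(image (fun x => x ^ (2 * l + 2))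
      {x : F | x ^ ((2 * l + 2) * l) = -1 ∧ x - x ^ (2 * l + 1) = c}) ≤ l + 3 := by
  have hT := card_nonsquare_line hF hσ h2 hl hc
  set T : Finset F := {x : F | x ^ ((2 * l + 2) * l) = -1 ∧ x - x ^ (2 * l + 1) = c} with hTdef
  set S := image (fun x => x ^ (2 * l + 2)) T with hS
  have key : ∀ y ∈ S.erase ((c / 2) ^ (2 * l + 2)), 2 ≤ #{x ∈ T | x ^ (2 * l + 2) = y} := by
    intro y hy
    rw [mem_erase, hS, mem_image] at hy
    obtain ⟨hy0, x, hx, rfl⟩ := hy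
    have hx' := hx
    simp only [hTdef, mem_filter, mem_univ, true_and] at hx'
    have hodd : Odd (2 * l + 1) := ⟨l, rfl⟩
    have hxx : x ^ ((2 * l + 1) * (2 * l + 1)) = x := by
      rw [← sq, ← hF]
      exact FiniteField.pow_card x
    have hne : x ≠ -x ^ (2 * l + 1) := by
      intro h
      apply hy0
      have : x = c / 2 := by
        rw [eq_div_iff h2, ← hx'.2]
        linear_combination h
      rw [this]
    have hnorm : (-x ^ (2 * l + 1)) ^ (2 * l + 2) = x ^ (2 * l + 2) := by
      rw [pow_succ, hodd.neg_pow, ← pow_mul, hxx]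
      ring
    refine (card_pair hne).ge.trans (card_le_card fun z hz => ?_)
    rw [mem_insert, mem_singleton] at hz
    rw [mem_filter]
    rcases hz with rfl | rfl
    · exact ⟨hx, rfl⟩
    · refine ⟨?_, hnorm⟩
      simp only [hTdef, mem_filter, mem_univ, true_and]
      constructor
      · rw [pow_mul, hnorm, ← pow_mul, hx'.1]
      · rw [hodd.neg_pow, ← pow_mul, hxx, ← hx'.2]
        ring
  have h1 : #(S.erase ((c / 2) ^ (2 * l + 2))) * 2 ≤ #T := by
    rw [card_eq_sum_card_image (fun x => x ^ (2 * l + 2)) T, ← smul_eq_mul]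
    refine (card_nsmul_le_sum _ _ 2 key).trans ?_
    exact sum_le_sum_of_subset (erase_subset _ _)
  have h3 := pred_card_le_card_erase (s := S) (a := (c / 2) ^ (2 * l + 2))
  omega

theorem exists_points_of_norms [DecidableEq F] {n k t : ℕ} (hq : IsPrimePow (2 * l + 1))
    (hF : Fintype.card F = (2 * l + 1) ^ 2) (hl : 0 < l) (ht : t ≤ l) (hk : k ≤ l + t)
    (Y : Finset F) (hY : ∀ y ∈ Y, y ^ l = -1) (hYt : t < #Y) (c : F) (hc : c ^ (2 * l) = -1)
    (b d : F) (hb : b ^ (2 * l + 1) = b) (hd : d ^ (2 * l + 1) = d)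
    (hn : #{x : F | x ^ (2 * l + 2) ∈ Y ∧ b + d * ((x - x ^ (2 * l + 1)) / c) ≠ 0} = n) :
    ∃ a v : Fin n → F, Function.Injective a ∧ (∀ s, v s ≠ 0) ∧
      ∀ i j : ℕ, i < k → j < k →
        ∑ s, v s ^ (2 * l + 1 + 1) * a s ^ ((2 * l + 1) * i + j) = 0 := by
  obtain ⟨σ, hσ, hz, -⟩ := exists_frobenius hq hF
  have hc0 : c ≠ 0 := by
    rintro rfl
    rw [zero_pow (by omega)] at hc
    simp at hc
  have hσc : σ c = -c := by rw [hσ, pow_succ, hc]; ring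
  have hY0 : ∀ y ∈ Y, y ≠ 0 := by
    rintro y hy rfl
    have := hY 0 hy
    rw [zero_pow (by omega)] at this
    simp at this
  have hσY : ∀ y ∈ Y, σ y = y := by
    intro y hy
    rw [hσ, pow_succ, mul_comm 2 l, pow_mul, hY y hy]
    ring
  let φ : F → F := fun y => (y * ∏ z ∈ Y.erase y, (y - z))⁻¹
  have hφ0 : ∀ y ∈ Y, φ y ≠ 0 := by
    intro y hy
    refine inv_ne_zero (mul_ne_zero (hY0 y hy) (prod_ne_zero_iff.mpr fun z hz => ?_))
    exact sub_ne_zero.mpr (ne_of_mem_erase hz).symm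
  have hσφ : ∀ y ∈ Y, σ (φ y) = φ y := by
    intro y hy
    simp only [φ, map_inv₀, map_mul, map_prod, map_sub, hσY y hy]
    rw [prod_congr rfl fun z hz => by rw [hσY z (mem_of_mem_erase hz)]]
  have hφsum : ∀ e, 1 ≤ e → e ≤ t → ∑ y ∈ Y, φ y * y ^ e = 0 := by
    intro e he1 he2
    rw [← sum_pow_div_prod_sub_eq_zero Y (c := e - 1) (by omega)]
    refine sum_congr rfl fun y hy => ?_
    obtain ⟨f, rfl⟩ := Nat.exists_eq_add_of_le' he1
    simp only [φ, Nat.add_sub_cancel, pow_succ]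
    have := hY0 y hy
    rw [mul_inv, div_eq_mul_inv]
    field_simp
  let w : F → F := fun x => c * x ^ (l + 1) * φ (x ^ (2 * l + 2)) *
    (b + d * ((x - x ^ (2 * l + 1)) / c))
  have hxP : ∀ x : F, x ^ (2 * l + 2) ∈ Y → x ≠ 0 := by
    rintro x hx rfl
    exact hY0 _ hx (zero_pow (by omega))
  refine exists_points_of_weight hF {x : F | x ^ (2 * l + 2) ∈ Y} w ?_ ?_ ?_
  · intro x hx hwx
    simp only [mem_filter, mem_univ, true_and] at hx
    have hxx : x ^ ((2 * l + 1) * (2 * l + 1)) = x := by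
      rw [← sq, ← hF]
      exact FiniteField.pow_card x
    have hσm : σ (x ^ (l + 1)) = -x ^ (l + 1) := by
      rw [hσ, ← pow_mul, show (l + 1) * (2 * l + 1) = (2 * l + 2) * l + (l + 1) by ring, pow_add,
        pow_mul, hY _ hx]
      ring
    have hσw : σ (w x) = w x := by
      simp only [w, map_mul, map_add, map_div₀, map_sub, hσc, hσm, hσφ _ hx]
      rw [hσ b, hσ d, hσ x, hσ (x ^ (2 * l + 1)), hb, hd, ← pow_mul, hxx]
      field_simp
      ring
    rw [hσ, pow_succ] at hσw
    exact mul_right_cancel₀ hwx (by rw [hσw, one_mul])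
  · rw [filter_filter, ← hn]
    congr 1
    ext x
    simp only [mem_filter, mem_univ, true_and, w]
    refine and_congr_right fun hx => not_congr ?_
    have h1 := hφ0 _ hx
    have h2 := hxP x hx
    simp [hc0, h1, h2]
  · intro i j hi hj
    have hS := fun i j hi hj => sum_norm_mem_eq_zero hF hz ht Y hY φ hφsum (i := i) (j := j) hi hj
    have h1 := hS i j (by omega) (by omega)
    have h2 := hS i (j + 1) (by omega) (by omega)
    have h3 := hS (i + 1) j (by omega) (by omega)
    calc _ = ∑ x : F with x ^ (2 * l + 2) ∈ Y,
        (c * b * (φ (x ^ (2 * l + 2)) * x ^ (l + 1 + (2 * l + 1) * i + j))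
        + (d * (φ (x ^ (2 * l + 2)) * x ^ (l + 1 + (2 * l + 1) * i + (j + 1)))
        - d * (φ (x ^ (2 * l + 2)) * x ^ (l + 1 + (2 * l + 1) * (i + 1) + j)))) := by
          refine sum_congr rfl fun x _ => ?_
          simp only [w]
          rw [show l + 1 + (2 * l + 1) * i + j = (l + 1) + ((2 * l + 1) * i + j) by ring,
            show l + 1 + (2 * l + 1) * i + (j + 1) = (l + 1) + ((2 * l + 1) * i + j) + 1 by ring,
            show l + 1 + (2 * l + 1) * (i + 1) + j
              = (l + 1) + ((2 * l + 1) * i + j) + (2 * l + 1) by ring]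
          generalize φ (x ^ (2 * l + 2)) = f
          generalize (2 * l + 1) * i + j = e
          rw [pow_add _ (l + 1 + e) (2 * l + 1)]
          generalize x ^ (2 * l + 1) = X
          field_simp
          ring
      _ = 0 := by
          rw [sum_add_distrib, sum_sub_distrib, ← mul_sum, ← mul_sum, ← mul_sum, h1, h2, h3]
          ring

theorem card_norm_mem [DecidableEq F] (hF : Fintype.card F = (2 * l + 1) ^ 2)
    (Y : Finset F) (hY : ∀ y ∈ Y, y ^ l = -1) :
    #{x : F | x ^ (2 * l + 2) ∈ Y} = #Y * (2 * l + 2) := by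
  rw [card_eq_sum_card_fiberwise (t := Y) (f := fun x => x ^ (2 * l + 2)) (by
    intro x hx
    simpa using hx)]
  refine sum_const_nat fun y hy => ?_
  refine Eq.trans (congrArg card ?_) (card_filter_pow_eq (card_sub_one hF).symm (y := y)
    (by rw [mul_comm, pow_mul, hY y hy]; norm_num))
  rw [filter_filter]
  ext x
  simp only [mem_filter, mem_univ, true_and]
  exact ⟨fun h => h.2, fun h => ⟨h ▸ hy, h⟩⟩

end SquareOrder

theorem thm_qminus_len_no_plus_one
    (q h τ r n : ℕ) (hq : IsPrimePow q) (hqo : Odd q)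
    (hh : 0 < h) (hhe : Even h) (hτ : 1 ≤ τ)
    (hdiv : q - 1 = h * (2 * τ + 1))
    (hr1 : h + 2 < 2 * r) (hr2 : r ≤ h)  -- i.e. h/2 + 1 < r ≤ h
    -- n = r(q²-1)/(2h)
    (hn : 2 * h * n = r * (q ^ 2 - 1))
    (k : ℕ) (hk1 : 1 ≤ k)
    -- k ≤ (h+2)(q-1)/(2h)
    (hk : 2 * h * k ≤ (h + 2) * (q - 1))
    (F : Type*) [Field F] [Fintype F] (hF : Fintype.card F = q ^ 2) :
    ∃ a v : Fin n → F, Function.Injective a ∧ (∀ l, v l ≠ 0) ∧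
      ∀ i j : ℕ, i < k → j < k →
        ∑ l, v l ^ (q + 1) * a l ^ (q * i + j) = 0 := by
  classical
  obtain ⟨l, rfl⟩ := hqo
  obtain ⟨g, rfl⟩ := hhe
  generalize ht : 2 * τ + 1 = t at hdiv
  have hlg : l = g * t := by
    have : 2 * l = 2 * (g * t) := by
      rw [show 2 * l = 2 * l + 1 - 1 by omega, hdiv]; ring
    omega
  have ht3 : 3 ≤ t := by omega
  have hg : 0 < g := by omega
  have hrg : g + 2 ≤ r := by omega
  have hl : 0 < l := by rw [hlg]; positivity
  have htl : t ≤ l := by rw [hlg]; exact Nat.le_mul_of_pos_left t hg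
  have hkl : k ≤ l + t := by
    rw [Nat.add_sub_cancel, hlg] at hk
    have : (4 * g) * k ≤ (4 * g) * (g * t + t) := by
      calc _ = 2 * (g + g) * k := by ring
        _ ≤ _ := hk
        _ = _ := by ring
    rw [hlg]
    exact Nat.le_of_mul_le_mul_left this (by omega)
  have hn' : n = r * t * (l + 1) := by
    have h1 : (2 * l + 1) ^ 2 - 1 = 4 * l * (l + 1) := by
      have : (2 * l + 1) ^ 2 = 4 * l * (l + 1) + 1 := by ring
      omega
    have : (4 * g) * n = (4 * g) * (r * t * (l + 1)) := by
      calc _ = 2 * (g + g) * n := by ring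
        _ = r * (4 * l * (l + 1)) := by rw [hn, h1]
        _ = r * (4 * (g * t) * (l + 1)) := by rw [← hlg]
        _ = _ := by ring
    exact Nat.eq_of_mul_eq_mul_left (by omega) this
  have hrt : (g + 2) * t ≤ r * t := Nat.mul_le_mul_right t hrg
  rw [add_mul, ← hlg] at hrt
  have hrt2 : r * t ≤ 2 * l := by
    calc r * t ≤ (g + g) * t := Nat.mul_le_mul_right t hr2
      _ = 2 * l := by rw [hlg]; ring
  obtain ⟨σ, hσ, -, h2⟩ := exists_frobenius hq hF
  have hcs := card_sub_one hF
  have hW : #{y : F | y ^ l = -1} = l :=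
    card_filter_pow_eq (e := 2 * (2 * l + 2)) (by rw [hcs]; ring) (by rw [pow_mul]; norm_num)
  obtain ⟨c, hc⟩ : ∃ c : F, c ^ (2 * l) = -1 := by
    have hV : #{b : F | b ^ (2 * l) = -1} = 2 * l :=
      card_filter_pow_eq (e := 2 * l + 2) (by rw [hcs, mul_comm])
        (by rw [show 2 * l + 2 = 2 * (l + 1) by ring, pow_mul]; norm_num)
    obtain ⟨c, hc⟩ := card_pos.mp (hV ▸ (by omega : 0 < 2 * l))
    exact ⟨c, by simpa using hc⟩
  have hc0 : c ≠ 0 := by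
    rintro rfl
    rw [zero_pow (by omega)] at hc
    simp at hc
  rcases Nat.even_or_odd' (r * t) with ⟨N, hN | hN⟩
  · obtain ⟨Y, hYsub, hYcard⟩ := exists_subset_card_eq (s := {y : F | y ^ l = -1}) (n := N)
      (by rw [hW]; omega)
    have hY : ∀ y ∈ Y, y ^ l = -1 := fun y hy => by simpa using hYsub hy
    refine exists_points_of_norms hq hF hl htl hkl Y hY (by omega) c hc 1 0 (one_pow _)
      (zero_pow (by omega)) ?_
    simp only [zero_mul, add_zero, ne_eq, one_ne_zero, not_false_eq_true, and_true]
    rw [card_norm_mem hF Y hY, hYcard, hn', hN]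
    ring
  · have hTcard := card_nonsquare_line hF hσ h2 hl hc
    have hScard := two_mul_card_image_norm_line_le hF hσ h2 hl hc
    set T : Finset F := {x : F | x ^ ((2 * l + 2) * l) = -1 ∧ x - x ^ (2 * l + 1) = c} with hT
    obtain ⟨Y, hSY, hYsub, hYcard⟩ := exists_subsuperset_card_eq
      (s := image (fun x => x ^ (2 * l + 2)) T) (t := {y : F | y ^ l = -1}) (n := N + 1)
      (by
        intro y hy
        obtain ⟨x, hx, rfl⟩ := mem_image.mp hy
        simp only [hT, mem_filter, mem_univ, true_and] at hx ⊢
        rw [← pow_mul, hx.1])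
      (by omega) (by rw [hW]; omega)
    have hY : ∀ y ∈ Y, y ^ l = -1 := fun y hy => by simpa using hYsub hy
    refine exists_points_of_norms hq hF hl htl hkl Y hY (by omega) c hc (-1) 1
      (Odd.neg_one_pow ⟨l, rfl⟩) (one_pow _) ?_
    have hTsub : T ⊆ univ.filter fun x : F => x ^ (2 * l + 2) ∈ Y := by
      intro x hx
      simpa using hSY (mem_image_of_mem _ hx)
    have hset : (univ.filter fun x : F =>
        x ^ (2 * l + 2) ∈ Y ∧ -1 + 1 * ((x - x ^ (2 * l + 1)) / c) ≠ 0) =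
        (univ.filter fun x : F => x ^ (2 * l + 2) ∈ Y) \ T := by
      ext x
      simp only [mem_filter, mem_univ, true_and, mem_sdiff, hT]
      refine and_congr_right fun hx => not_congr ?_
      rw [pow_mul, hY _ hx, one_mul, neg_add_eq_zero, eq_comm, div_eq_one_iff_eq hc0]
      simp
    rw [hset, card_sdiff_of_subset hTsub, card_norm_mem hF Y hY, hYcard, hTcard, hn', hN,
      show (N + 1) * (2 * l + 2) = (2 * N + 1) * (l + 1) + (l + 1) by ring, Nat.add_sub_cancel]
end

section
/- Let q be an odd prime power, h an even positive integer with (q+1)/h = 2τ+1 for some integer τ ≥ 1, and m = (q^2−1)/(2h). Let t be an integer with 0 ≤ t ≤ h/2 − 1 and let k be an integer with 1 ≤ k and 2hk ≤ (h+2t+1)(q+1) − 3h. Then for all integers i, j, s with 0 ≤ i, j ≤ k−1 and s ≥ 0, if q·i + j = s·m, then either s = 0, or s is odd with 1 ≤ s ≤ h−1, or s is even with h−2t ≤ s ≤ h+2t, or s is odd with 2h−2t+1 ≤ s ≤ h+2t−1 (the ranges being empty when their lower bound exceeds their upper bound). -/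
theorem lemma_qplus_plus_one_part1
    (q h τ m : ℕ) (hq : IsPrimePow q) (hqo : Odd q)
    (hh : 0 < h) (hhe : Even h) (hτ : 1 ≤ τ)
    (hdiv : q + 1 = h * (2 * τ + 1))
    (hm : 2 * h * m = q ^ 2 - 1)
    (t k : ℕ) (htlt : 2 * t + 2 ≤ h)  -- i.e. 0 ≤ t ≤ h/2 - 1
    (hk1 : 1 ≤ k)
    (hk : 2 * h * k + 3 * h ≤ (h + 2 * t + 1) * (q + 1))  -- i.e. k ≤ (h+2t+1)(q+1)/(2h) - 3/2
    (i j s : ℕ) (hi : i < k) (hj : j < k)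
    (hij : q * i + j = s * m) :
    s = 0 ∨
    (Odd s ∧ 1 ≤ s ∧ s ≤ h - 1) ∨
    (Even s ∧ h - 2 * t ≤ s ∧ s ≤ h + 2 * t) ∨
    (Odd s ∧ 2 * h - 2 * t + 1 ≤ s ∧ s ≤ h + 2 * t - 1) := by
  obtain ⟨N, hN⟩ : ∃ N, N = 2 * τ + 1 := ⟨_, rfl⟩
  have hN3 : 3 ≤ N := by omega
  have hNodd : Odd N := ⟨τ, hN⟩
  have hNpos : (0 : ℤ) < N := by omega
  rw [← hN] at hdiv
  have hq1 : 1 < q := hq.one_lt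
  have hm2 : (2 * m : ℤ) = N * (q - 1) := by
    have hm' : (2 * h * m : ℤ) = q ^ 2 - 1 := by
      have h1 : 1 ≤ q ^ 2 := Nat.one_le_pow _ _ (by omega)
      have := congrArg (Nat.cast : ℕ → ℤ) hm
      push_cast [Nat.cast_sub h1] at this
      exact this
    have hd : (q + 1 : ℤ) = h * N := by exact_mod_cast hdiv
    have h0 : (h : ℤ) ≠ 0 := by exact_mod_cast hh.ne'
    apply mul_left_cancel₀ h0
    linear_combination hm' + (q - 1 : ℤ) * hd
  have hkN : 2 * k + 3 ≤ (h + 2 * t + 1) * N := by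
    rw [hdiv] at hk
    apply Nat.le_of_mul_le_mul_left _ hh
    linarith
  have hdZ : (q + 1 : ℤ) = h * N := by exact_mod_cast hdiv
  have hkZ : (2 * k + 3 : ℤ) ≤ (h + 2 * t + 1) * N := by exact_mod_cast hkN
  have hkq : (k : ℤ) + 2 ≤ q := by
    have h1 : ((h : ℤ) + 2 * t + 1) * N ≤ (2 * h - 1) * N :=
      mul_le_mul_of_nonneg_right (by omega) hNpos.le
    have h2 : (2 * h - 1 : ℤ) * N = 2 * (q + 1) - N := by rw [hdZ]; ring
    omega
  -- `q * c = s * N + 2 * j` with `c = s * N - 2 * i` determines both digits from `c`.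
  obtain ⟨c, hc⟩ : ∃ c : ℤ, c = s * N - 2 * i := ⟨_, rfl⟩
  have hijZ : (q * i + j : ℤ) = s * m := by exact_mod_cast hij
  have hqc : (q : ℤ) * c = s * N + 2 * j := by
    rw [hc]; linear_combination (-2 : ℤ) * hijZ - s * hm2
  have hsum : ((q : ℤ) - 1) * c = 2 * i + 2 * j := by linear_combination hqc - hc
  have hc0 : 0 ≤ c := by
    by_contra! hneg
    have : ((q : ℤ) - 1) * c < 0 := mul_neg_of_pos_of_neg (by omega) hneg
    omega
  have hc4 : c < 4 := by
    by_contra! hge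
    have : ((q : ℤ) - 1) * 4 ≤ (q - 1) * c := mul_le_mul_of_nonneg_left hge (by omega)
    omega
  have hlt_of {a b : ℤ} (hab : a * N < b * N) : a < b := lt_of_mul_lt_mul_right hab hNpos.le
  have hpar : Odd s ↔ Odd c := by
    have : (s : ℤ) * N = c + 2 * i := by omega
    rw [← Int.odd_coe_nat]
    have h1 : Odd ((s : ℤ) * N) ↔ Odd (s : ℤ) := by
      simp [Int.odd_mul, hNodd]
    rw [← h1, this]
    simp [Int.odd_add]
  obtain ⟨e, he⟩ := hhe
  have upper : (s : ℤ) < h + 2 * t + 1 := hlt_of (by omega)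
  have lower (b : ℤ) (hb : c * (q + 1) = b * N) : b - s < h + 2 * t + 1 := by
    apply hlt_of
    have : (b - s) * N = 2 * j + c := by linear_combination hqc - hb
    omega
  obtain rfl | rfl | rfl | rfl : c = 0 ∨ c = 1 ∨ c = 2 ∨ c = 3 := by omega
  · left
    have : (s : ℤ) * N = 0 := by omega
    simpa [show N ≠ 0 by omega] using this
  · right; left
    have hs : Odd s := hpar.2 (by decide)
    have hsh : (s : ℤ) < h := hlt_of (by omega)
    exact ⟨hs, hs.pos, by omega⟩
  · right; right; left
    have hs : Even s := Nat.not_odd_iff_even.1 fun hs => absurd (hpar.1 hs) (by decide)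
    have h2 := lower (2 * h) (by rw [hdZ]; ring)
    obtain ⟨u, hu⟩ := hs
    exact ⟨⟨u, hu⟩, by omega, by omega⟩
  · right; right; right
    have hs : Odd s := hpar.2 (by decide)
    have h2 := lower (3 * h) (by rw [hdZ]; ring)
    obtain ⟨u, hu⟩ := hs
    exact ⟨⟨u, hu⟩, by omega, by omega⟩
end

section
/- Let q be an odd prime power, h an even positive integer with (q+1)/h = 2τ+1 for some integer τ ≥ 1, and m = (q^2−1)/(2h). Let t be an integer with 0 ≤ t < h/2 and let k be an integer with 1 ≤ k and 2hk ≤ (h+2t+1)(q+1) − 3h. Then for all integers i, j, s with 0 ≤ i, j ≤ k−1 and s ≥ 0, if q·i + j + (q+1)/2 = s·m, then either s is even with 2 ≤ s ≤ h−2, or s is odd with h−2t+1 ≤ s ≤ h+2t−1, or s is even with 2h−2t ≤ s ≤ h+2t (the ranges being empty when their lower bound exceeds their upper bound). -/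
theorem lemma_qplus_no_plus_one_part1
    (q h τ m : ℕ) (hq : IsPrimePow q) (hqo : Odd q)
    (hh : 0 < h) (hhe : Even h) (hτ : 1 ≤ τ)
    (hdiv : q + 1 = h * (2 * τ + 1))
    (hm : 2 * h * m = q ^ 2 - 1)
    (t k : ℕ) (htlt : 2 * t < h)  -- i.e. 0 ≤ t < h/2
    (hk1 : 1 ≤ k)
    (hk : 2 * h * k + 3 * h ≤ (h + 2 * t + 1) * (q + 1))  -- i.e. k ≤ (h+2t+1)(q+1)/(2h) - 3/2
    (i j s : ℕ) (hi : i < k) (hj : j < k)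
    (hij : 2 * (q * i + j) + (q + 1) = 2 * (s * m)) :  -- i.e. qi + j + (q+1)/2 = s m
    (Even s ∧ 2 ≤ s ∧ s ≤ h - 2) ∨
    (Odd s ∧ h - 2 * t + 1 ≤ s ∧ s ≤ h + 2 * t - 1) ∨
    (Even s ∧ 2 * h - 2 * t ≤ s ∧ s ≤ h + 2 * t) := by
  obtain ⟨g, rfl⟩ := hhe
  obtain ⟨n, hn⟩ : ∃ n : ℤ, n = 2 * τ + 1 := ⟨_, rfl⟩
  have hn3 : 3 ≤ n := by omega
  have hg : (1 : ℤ) ≤ g := by omega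
  have htg : (t : ℤ) + 1 ≤ g := by omega
  have hqn : (q : ℤ) + 1 = 2 * g * n := by
    rw [hn, two_mul (g : ℤ)]; exact_mod_cast hdiv
  have hq1 : 1 ≤ q ^ 2 := Nat.one_le_pow _ _ hq.pos
  have hq5 : (5 : ℤ) ≤ q := by nlinarith
  have hmn : 2 * (m : ℤ) = (q - 1) * n := by
    zify [hq1] at hm
    have : (2 * g : ℤ) * (2 * m) = 2 * g * ((q - 1) * n) := by
      linear_combination hm + (q - 1 : ℤ) * hqn
    exact mul_left_cancel₀ (by omega) this
  have hkn : 2 * (k : ℤ) + 3 ≤ (2 * g + 2 * t + 1) * n := by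
    zify at hk
    rw [hqn] at hk
    have : (2 * g : ℤ) * (2 * k + 3) ≤ 2 * g * ((2 * g + 2 * t + 1) * n) := by linarith
    exact le_of_mul_le_mul_left this (by omega)
  have hi' : (i : ℤ) + 1 ≤ k := by omega
  have hj' : (j : ℤ) + 1 ≤ k := by omega
  have hsn : 2 * ((q : ℤ) * i + j) + (q + 1) = s * ((q - 1) * n) := by
    zify at hij
    linear_combination hij + (s : ℤ) * hmn
  have hs0 : 0 < s := by
    by_contra h0
    obtain rfl : s = 0 := by omega
    omega
  have hs_le : s ≤ 2 * g + 2 * t := by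
    by_contra! hlt
    have hA : (2 * g + 2 * t + 1 : ℤ) ≤ s := by omega
    have h1 := mul_le_mul_of_nonneg_right hA
      (mul_nonneg (by omega : (0 : ℤ) ≤ q - 1) (by omega : 0 ≤ n))
    have h2 := mul_le_mul_of_nonneg_left hi' (by omega : (0 : ℤ) ≤ q)
    have h3 := mul_le_mul_of_nonneg_left hkn (by omega : (0 : ℤ) ≤ q + 1)
    have h4 := mul_le_mul_of_nonneg_right htg (by omega : 0 ≤ n)
    nlinarith
  rcases Nat.even_or_odd s with hs | hs
  · by_cases hsmall : s ≤ g + g - 2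
    · exact Or.inl ⟨hs, by grind, hsmall⟩
    refine Or.inr (Or.inr ⟨hs, ?_, by omega⟩)
    by_contra! hlt
    obtain ⟨u, rfl⟩ := hs
    have hgu : (g : ℤ) ≤ u := by omega
    have hut : (u : ℤ) + t + 1 ≤ 2 * g := by omega
    have hc : (q : ℤ) * (u * n - i) = j + g * n + u * n := by
      push_cast at hsn
      linarith
    have h1 := mul_le_mul_of_nonneg_right hgu (by omega : 0 ≤ n)
    have h2 := mul_le_mul_of_nonneg_right hut (by omega : 0 ≤ n)
    have hc2 : 2 ≤ u * n - i := by
      by_contra! hc1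
      have := mul_le_mul_of_nonneg_left (by omega : u * n - i ≤ 1) (by omega : (0 : ℤ) ≤ q)
      linarith
    have := mul_le_mul_of_nonneg_left hc2 (by omega : (0 : ℤ) ≤ q)
    linarith
  · refine Or.inr (Or.inl ⟨hs, ?_, by grind⟩)
    by_contra! hlt
    have hst : (s : ℤ) + 2 * t + 1 ≤ 2 * g := by grind
    obtain ⟨u, rfl⟩ := hs
    have h2 := mul_le_mul_of_nonneg_right hst (by omega : 0 ≤ n)
    have hu : 0 ≤ u * n := by positivity
    have hτ' : (1 : ℤ) ≤ τ := by omega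
    have hc : (q : ℤ) * (u * n + τ - i) = j + (u * n + τ + 1) := by
      push_cast at hsn
      rw [show (2 * (u : ℤ) + 1) * ((q - 1) * n) = (q - 1) * (2 * (u * n) + n) by ring,
        hn] at hsn
      rw [hn]
      linarith
    have hc1 : 1 ≤ u * n + τ - i := by
      by_contra! hc0
      have := mul_le_mul_of_nonneg_left (by omega : u * n + τ - i ≤ 0) (by omega : (0 : ℤ) ≤ q)
      linarith
    have := mul_le_mul_of_nonneg_left hc1 (by omega : (0 : ℤ) ≤ q)
    push_cast at h2
    linarith
end

section
/- Let q be an odd prime power, h an even positive integer with (q+1)/h = 2τ+1 for some integer τ ≥ 1, and m = (q^2−1)/(2h). Let t be an integer with 1 ≤ t ≤ h/2 and let k be an integer with 1 ≤ k and 2hk ≤ (h+2t)(q+1) − 4h. Then for all integers i, j, s with 0 ≤ i, j ≤ k−1 and s ≥ 0, if q·i + j + (q+1)/2 = s·m, then either s is even with 2 ≤ s ≤ h−2, or s is odd with h−2t+1 ≤ s ≤ h+2t−1, or s is even with 2h−2t+2 ≤ s ≤ h+2t−2 (the ranges being empty when their lower bound exceeds their upper bound). -/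
/-- With `q = 2 g n - 1`, a representation `q i + j + gn = 2 u · n(gn - 1)` by small digits `i`, `j`
has `i = un - w` with `w = 1` or `w = 2`, which confines `u` to one of two ranges. -/
theorem even_multiple_bounds {g n t u i j : ℤ} (hg : 0 < g) (hn : 3 ≤ n) (htg : t ≤ g)
    (hi : 0 ≤ i) (hj : 0 ≤ j) (hi' : i + 3 ≤ (g + t) * n) (hj' : j + 3 ≤ (g + t) * n)
    (hu : 0 ≤ u) (h : (2 * g * n - 1) * i + j + g * n = 2 * u * (n * (g * n - 1))) :
    (1 ≤ u ∧ u ≤ g - 1) ∨ (2 * g - t + 1 ≤ u ∧ u ≤ g + t - 1) := by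
  obtain ⟨w, rfl⟩ : ∃ w, i = u * n - w := ⟨u * n - i, by ring⟩
  obtain rfl : j = w * (2 * g * n - 1) - (u + g) * n := by linear_combination h
  have hgn : 3 ≤ g * n := by nlinarith
  have htn : t * n ≤ g * n := by nlinarith
  have hun : 0 ≤ u * n := by positivity
  have hw1 : 1 ≤ w := by
    by_contra! hw
    nlinarith
  have hw2 : w ≤ 2 := by
    by_contra! hw
    nlinarith
  obtain rfl | rfl : w = 1 ∨ w = 2 := by omega
  · left
    constructor
    · by_contra! hlt
      nlinarith
    · by_contra! hlt
      nlinarith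
  · right
    constructor
    · by_contra! hlt
      nlinarith
    · by_contra! hlt
      nlinarith

/-- With `q = 2 g n - 1` and `n = 2τ + 1`, a representation `q i + j + gn = (2 u + 1) · n(gn - 1)` by
small digits `i`, `j` has `i = un + τ - 1`, which confines `u` to a single range. -/
theorem odd_multiple_bounds {g n τ t u i j : ℤ} (hg : 0 < g) (hτ : 1 ≤ τ) (hn : n = 2 * τ + 1)
    (htg : t ≤ g) (hi : 0 ≤ i) (hj : 0 ≤ j)
    (hi' : i + 3 ≤ (g + t) * n) (hj' : j + 3 ≤ (g + t) * n) (hu : 0 ≤ u)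
    (h : (2 * g * n - 1) * i + j + g * n = (2 * u + 1) * (n * (g * n - 1))) :
    g - t ≤ u ∧ u ≤ g + t - 1 := by
  obtain ⟨w, rfl⟩ : ∃ w, i = u * n + τ - w := ⟨u * n + τ - i, by ring⟩
  obtain rfl : j = w * (2 * g * n - 1) - u * n - τ - 1 := by
    linear_combination h + (g * n - 1) * hn
  have hgn : 3 ≤ g * n := by nlinarith
  have htn : t * n ≤ g * n := by nlinarith
  have hun : 0 ≤ u * n := mul_nonneg hu (by omega)
  have hw1 : 1 ≤ w := by
    by_contra! hw
    nlinarith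
  have hw2 : w < 2 := by
    by_contra! hw
    nlinarith
  obtain rfl : w = 1 := by omega
  constructor
  · by_contra! hlt
    nlinarith
  · by_contra! hlt
    nlinarith

theorem lemma_qplus_no_plus_one_part2
    (q h τ m : ℕ) (hq : IsPrimePow q) (hqo : Odd q)
    (hh : 0 < h) (hhe : Even h) (hτ : 1 ≤ τ)
    (hdiv : q + 1 = h * (2 * τ + 1))
    (hm : 2 * h * m = q ^ 2 - 1)
    (t k : ℕ) (ht1 : 1 ≤ t) (hth : 2 * t ≤ h)  -- i.e. 1 ≤ t ≤ h/2
    (hk1 : 1 ≤ k)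
    (hk : 2 * h * k + 4 * h ≤ (h + 2 * t) * (q + 1))  -- i.e. k ≤ (h+2t)(q+1)/(2h) - 2
    (i j s : ℕ) (hi : i < k) (hj : j < k)
    (hij : 2 * (q * i + j) + (q + 1) = 2 * (s * m)) :  -- i.e. qi + j + (q+1)/2 = s m
    (Even s ∧ 2 ≤ s ∧ s ≤ h - 2) ∨
    (Odd s ∧ h - 2 * t + 1 ≤ s ∧ s ≤ h + 2 * t - 1) ∨
    (Even s ∧ 2 * h - 2 * t + 2 ≤ s ∧ s ≤ h + 2 * t - 2) := by
  obtain ⟨g, rfl⟩ := hhe.exists_two_nsmul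
  simp only [smul_eq_mul] at *
  have hg : 0 < g := by omega
  have hq1 : 1 ≤ q ^ 2 := Nat.one_le_pow _ _ hq.pos
  have hqz : (q : ℤ) = 2 * g * (2 * τ + 1) - 1 := by
    have : (q : ℤ) + 1 = 2 * g * (2 * τ + 1) := by exact_mod_cast hdiv
    linarith
  have hmz : (m : ℤ) = (2 * τ + 1) * (g * (2 * τ + 1) - 1) := by
    have hmq : 2 * (2 * (g : ℤ)) * m = (q : ℤ) ^ 2 - 1 := by
      zify [hq1] at hm
      exact hm
    rw [hqz] at hmq
    have hg4 : (4 * (g : ℤ)) ≠ 0 := by positivity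
    apply mul_left_cancel₀ hg4
    linear_combination hmq
  have hkz : (k : ℤ) + 2 ≤ (g + t) * (2 * τ + 1) := by
    have hkq : 2 * (2 * (g : ℤ)) * k + 4 * (2 * g) ≤ (2 * g + 2 * t) * (q + 1) := by
      exact_mod_cast hk
    rw [hqz] at hkq
    have hg4 : 0 < 4 * (g : ℤ) := by positivity
    apply le_of_mul_le_mul_left _ hg4
    linarith
  have hijz : (2 * g * (2 * τ + 1) - 1) * (i : ℤ) + j + g * (2 * τ + 1) =
      s * ((2 * τ + 1) * (g * (2 * τ + 1) - 1)) := by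
    have : 2 * ((q : ℤ) * i + j) + (q + 1) = 2 * (s * m) := by exact_mod_cast hij
    rw [hqz, hmz] at this
    linarith
  have hiz : (i : ℤ) + 3 ≤ (g + t) * (2 * τ + 1) := by omega
  have hjz : (j : ℤ) + 3 ≤ (g + t) * (2 * τ + 1) := by omega
  obtain ⟨u, rfl | rfl⟩ := s.even_or_odd'
  · push_cast at hijz
    have hbounds := even_multiple_bounds (u := u) (t := t) (by omega) (by omega) (by omega)
      (by omega) (by omega) hiz hjz (by omega) hijz
    have heven : Even (2 * u) := even_two_mul u
    obtain hlow | hhigh := hbounds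
    · exact Or.inl ⟨heven, by omega, by omega⟩
    · exact Or.inr (Or.inr ⟨heven, by omega, by omega⟩)
  · push_cast at hijz
    have hbounds := odd_multiple_bounds (u := u) (t := t) (by omega) (by omega) rfl (by omega)
      (by omega) (by omega) hiz hjz (by omega) hijz
    exact Or.inr (Or.inl ⟨odd_two_mul_add_one u, by omega, by omega⟩)
end

section
/- Let q be an odd prime power, h an even positive integer with (q+1)/h = 2τ+1 for some integer τ ≥ 1, let r be an integer with h/2 ≤ r ≤ h, set n = r(q^2−1)/(2h), and let k be an integer with 1 ≤ k and 2hk ≤ (h+1)(q+1) − 3h. Then there exist pairwise distinct elements a_1,…,a_n of F_{q^2} and nonzero elements v_1,…,v_n of F_{q^2} such that Σ_{l=1}^n v_l^{q+1} a_l^{q·i+j} = 0 for all integers 0 ≤ i, j ≤ k−1 (with the convention 0^0 = 1); that is, the generalized Reed–Solomon code GRS_k(a,v) is a Hermitian self-orthogonal [n, k, n−k+1] MDS code over F_{q^2}, which by the Hermitian construction yields an [[n, n−2k, k+1]]_q quantum MDS code. -/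
open Finset

theorem sub_pow_of_card_eq_sq {F : Type*} [Field F] [Fintype F] {q : ℕ} (hq : IsPrimePow q)
    (hF : Fintype.card F = q ^ 2) (a b : F) : (a - b) ^ q = a ^ q - b ^ q := by
  obtain ⟨p, m, hp, hm, rfl⟩ := hq
  obtain ⟨p', hchar, n, hp', hcard⟩ := FiniteField.card' F
  have hpp : p' = p := by
    have h1 : p' ∣ (p ^ m) ^ 2 := by
      rw [← hF, hcard]
      exact dvd_pow_self _ n.ne_zero
    exact (Nat.prime_dvd_prime_iff_eq hp' hp.nat_prime).1
      (hp'.dvd_of_dvd_pow (hp'.dvd_of_dvd_pow h1))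
  subst hpp
  have : Fact p'.Prime := ⟨hp'⟩
  exact sub_pow_char_pow a b m

theorem exists_isPrimitiveRoot_card_sub_one (F : Type*) [Field F] [Fintype F] :
    ∃ ω : F, IsPrimitiveRoot ω (Fintype.card F - 1) := by
  classical
  obtain ⟨g, hg⟩ := IsCyclic.exists_generator (α := Fˣ)
  refine ⟨g, IsPrimitiveRoot.coe_units_iff.2 ?_⟩
  rw [← Fintype.card_units, ← Nat.card_eq_fintype_card, ← orderOf_eq_card_of_forall_mem_zpowers hg]
  exact IsPrimitiveRoot.orderOf g

theorem sub_pow_eq_neg_div_of_pow_succ_eq_one {F : Type*} [Field F] {q : ℕ}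
    (hsub : ∀ a b : F, (a - b) ^ q = a ^ q - b ^ q) {x y : F}
    (hx : x ^ (q + 1) = 1) (hy : y ^ (q + 1) = 1) :
    (x - y) ^ q = -(x * y)⁻¹ * (x - y) := by
  have hx0 : x ≠ 0 := by rintro rfl; simp at hx
  have hy0 : y ≠ 0 := by rintro rfl; simp at hy
  have hxq : x ^ q = x⁻¹ := eq_inv_of_mul_eq_one_left (by rw [← pow_succ, hx])
  have hyq : y ^ q = y⁻¹ := eq_inv_of_mul_eq_one_left (by rw [← pow_succ, hy])
  rw [hsub, hxq, hyq]
  field_simp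
  ring

/-- The weights `(x i - y) ^ D / ∏ j ≠ i, (x i - x j)` of Lagrange interpolation at nodes of
norm one satisfy a Frobenius relation with a common constant. -/
theorem exists_lagrange_weights {F : Type*} [Field F] {q r D : ℕ}
    (hsub : ∀ a b : F, (a - b) ^ q = a ^ q - b ^ q) {x : Fin r → F}
    (hxinj : Function.Injective x) (hx : ∀ s, x s ^ (q + 1) = 1)
    {y : F} (hy : y ^ (q + 1) = 1) (hxy : ∀ s, x s ≠ y) :
    ∃ (W : Fin r → F) (κ : F), (∀ s, W s ≠ 0) ∧
      (∀ s, W s ^ q * x s ^ (D + 2) = κ * W s * x s ^ r) ∧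
      ∀ t, D + t + 1 < r → ∑ s, W s * x s ^ t = 0 := by
  have hx0 : ∀ s, x s ≠ 0 := fun s h ↦ by simpa [h] using hx s
  have hy0 : y ≠ 0 := by rintro rfl; simp at hy
  refine ⟨fun s ↦ (x s - y) ^ D / ∏ j ∈ univ.erase s, (x s - x j),
    (-y⁻¹) ^ D * ((-1) ^ (r - 1) * ∏ j, x j), fun s ↦ ?_, fun s ↦ ?_, fun t ht ↦ ?_⟩
  · refine div_ne_zero (pow_ne_zero _ (sub_ne_zero.2 (hxy s))) (prod_ne_zero_iff.2 fun j hj ↦ ?_)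
    exact sub_ne_zero.2 fun h ↦ (mem_erase.1 hj).1 (hxinj h).symm
  · have hpow : x s ^ r = x s ^ (r - 1) * x s := by
      rw [← pow_succ, Nat.sub_add_cancel s.pos]
    have hP : (∏ j ∈ univ.erase s, (x s - x j)) ^ q * ((-1) ^ (r - 1) * ∏ j, x j) * x s ^ r
        = (∏ j ∈ univ.erase s, (x s - x j)) * x s ^ 2 := by
      have h1 : ∏ j, x j = x s * ∏ j ∈ univ.erase s, x j := (mul_prod_erase _ _ (mem_univ s)).symm
      have h2 : (∏ j ∈ univ.erase s, (x s - x j)) ^ q * ((-1) ^ (r - 1) *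
          ∏ j ∈ univ.erase s, x j) * x s ^ (r - 1) = ∏ j ∈ univ.erase s, (x s - x j) := by
        have hc : #(univ.erase s) = r - 1 := by simp
        rw [← hc, ← prod_const, ← prod_const, ← prod_pow, ← prod_mul_distrib, ← prod_mul_distrib,
          ← prod_mul_distrib]
        refine prod_congr rfl fun j _ ↦ ?_
        rw [sub_pow_eq_neg_div_of_pow_succ_eq_one hsub (hx s) (hx j)]
        have := hx0 s
        have := hx0 j
        field_simp
      rw [h1, hpow]
      linear_combination x s ^ 2 * h2
    have hprod : ∏ j ∈ univ.erase s, (x s - x j) ≠ 0 := prod_ne_zero_iff.2 fun j hj ↦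
      sub_ne_zero.2 fun h ↦ (mem_erase.1 hj).1 (hxinj h).symm
    have hnum : ((x s - y) ^ D) ^ q * x s ^ D = (-y⁻¹) ^ D * (x s - y) ^ D := by
      rw [← pow_mul, mul_comm D q, pow_mul, sub_pow_eq_neg_div_of_pow_succ_eq_one hsub (hx s) hy,
        ← mul_pow, ← mul_pow]
      congr 1
      have := hx0 s
      field_simp
    rw [div_pow, pow_add]
    rw [div_mul_eq_mul_div, div_eq_iff (pow_ne_zero _ hprod), mul_div_assoc', div_mul_eq_mul_div,
      div_mul_eq_mul_div, eq_div_iff hprod]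
    linear_combination (x s ^ 2 * ∏ j ∈ univ.erase s, (x s - x j)) * hnum -
      ((-y⁻¹) ^ D * (x s - y) ^ D) * hP
  · have hdeg : ((Polynomial.X - Polynomial.C y) ^ D * Polynomial.X ^ t).degree
        = ((D + t : ℕ) : WithBot ℕ) := by
      rw [Polynomial.degree_mul, Polynomial.degree_pow, Polynomial.degree_X_sub_C,
        Polynomial.degree_X_pow]
      simp
    have := Lagrange.coeff_eq_sum (s := univ) hxinj.injOn
      (P := (Polynomial.X - Polynomial.C y) ^ D * Polynomial.X ^ t)
      (by rw [hdeg, card_univ, Fintype.card_fin]; exact_mod_cast (by omega))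
    rw [Polynomial.coeff_eq_zero_of_degree_lt
      (by rw [hdeg, card_univ, Fintype.card_fin]; exact_mod_cast (by omega))] at this
    rw [this]
    refine sum_congr rfl fun s _ ↦ ?_
    simp [div_mul_eq_mul_div]

theorem exists_pow_succ_eq_of_pow_eq_self {F : Type*} [Field F] {q : ℕ} (hq : 1 < q) {ω z : F}
    (hω : IsPrimitiveRoot ω (q ^ 2 - 1)) (hz0 : z ≠ 0) (hz : z ^ q = z) :
    ∃ v : F, v ^ (q + 1) = z := by
  obtain ⟨p, rfl⟩ : ∃ p, q = p + 1 := ⟨q - 1, by omega⟩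
  have hp : 0 < p := by omega
  have hcard : (p + 1) ^ 2 - 1 = p * (p + 2) := by
    rw [Nat.sub_eq_iff_eq_add (Nat.one_le_pow _ _ (by omega))]; ring
  rw [hcard] at hω
  have hz1 : z ^ p = 1 := mul_right_cancel₀ hz0 (by rw [← pow_succ, hz, one_mul])
  have : NeZero (p * (p + 2)) := ⟨by positivity⟩
  obtain ⟨i, -, rfl⟩ := hω.eq_pow_of_pow_eq_one (ξ := z) (by rw [pow_mul, hz1, one_pow])
  rw [← pow_mul, hω.pow_eq_one_iff_dvd, mul_comm i, Nat.mul_dvd_mul_iff_left hp] at hz1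
  obtain ⟨j, rfl⟩ := hz1
  exact ⟨ω ^ j, by rw [← pow_mul, mul_comm]⟩

theorem exists_odd_multiple_of_dvd {B H τ k i j : ℕ} (hτ : 1 ≤ τ) (hB : B + 1 = H * (2 * τ + 1))
    (hk : k ≤ B + τ) (hi : i < k) (hj : j < k)
    (hdvd : (2 * τ + 1) * B ∣ (2 * B + 1) * i + j + (2 * B + 1 - 2 * τ)) :
    ∃ t, t + 1 < H ∧
      (2 * B + 1) * i + j + (2 * B + 1 - 2 * τ) = (2 * τ + 1) * B * (3 + 2 * t) := by
  have hH : 0 < H := Nat.pos_of_ne_zero (by rintro rfl; simp at hB)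
  have hBτ : 2 * τ ≤ B := by nlinarith
  obtain ⟨E, hE⟩ : ∃ E, E = (2 * B + 1) * i + j + (2 * B + 1 - 2 * τ) := ⟨_, rfl⟩
  rw [← hE] at hdvd ⊢
  have hE' : (E : ℤ) = (2 * B + 1) * i + j + (2 * B + 1 - 2 * τ) := by
    rw [hE]; push_cast [show 2 * τ ≤ 2 * B + 1 by omega]; ring
  have hB' : (B : ℤ) + 1 = H * (2 * τ + 1) := by exact_mod_cast hB
  have hdvd' : ((2 * τ + 1) * B : ℤ) ∣ E := by exact_mod_cast hdvd
  obtain ⟨d, hd⟩ : (2 * τ + 1 : ℤ) ∣ (j : ℤ) - i := by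
    have h1 : (2 * τ + 1 : ℤ) ∣ E := (Dvd.intro _ rfl).trans hdvd'
    have : (j : ℤ) - i = E - (2 * τ + 1) * (2 * H * i + 2 * H - 1) := by
      rw [hE']; linear_combination (-2 * (i : ℤ) - 2) * hB'
    rw [this]
    exact dvd_sub h1 (Dvd.intro _ rfl)
  obtain ⟨c, hc⟩ : (B : ℤ) ∣ (i : ℤ) + j + 1 - 2 * τ := by
    have h1 : (B : ℤ) ∣ E := (Dvd.intro_left _ rfl).trans hdvd'
    have : (i : ℤ) + j + 1 - 2 * τ = E - B * (2 * i + 2) := by rw [hE']; ring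
    rw [this]
    exact dvd_sub h1 (Dvd.intro _ rfl)
  have hc0 : -1 < c := by
    by_contra! hcon
    nlinarith
  have hc2 : c < 2 := by
    by_contra! hcon
    nlinarith
  have hodd : ∃ m : ℤ, (2 * τ + 1) * d = 2 * m + d := ⟨τ * d, by ring⟩
  have hodd' : ∃ m : ℤ, (H * (2 * τ + 1) : ℤ) = 2 * m + H := ⟨H * τ, by ring⟩
  obtain ⟨m, hm⟩ := hodd
  obtain ⟨m', hm'⟩ := hodd'
  interval_cases c
  · have h1 : d < 1 := by
      by_contra! hcon
      nlinarith
    have h2 : -1 < d := by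
      by_contra! hcon
      nlinarith
    obtain rfl : d = 0 := by omega
    omega
  · have h1 : d < H := by
      by_contra! hcon
      nlinarith
    have h2 : -(H : ℤ) < d := by
      by_contra! hcon
      nlinarith
    obtain ⟨t, ht⟩ : ∃ t : ℕ, (t : ℤ) * 2 = H - 2 - d :=
      ⟨((H - 2 - d) / 2).toNat, by omega⟩
    refine ⟨t, by omega, ?_⟩
    zify
    rw [hE']
    have : (3 : ℤ) + 2 * t = H + 1 - d := by linarith
    rw [this]
    linear_combination (B + 1 : ℤ) * hc - (B : ℤ) * hd + (B : ℤ) * hB'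

theorem exists_coset_weights {F : Type*} [Field F] {q B m τ r : ℕ}
    (hsub : ∀ a b : F, (a - b) ^ q = a ^ q - b ^ q) (hq : q = 2 * B + 1)
    (hB : B + 1 = (m + 1) * (2 * τ + 1)) (hτ : 1 ≤ τ) (hr1 : m + 1 ≤ r) (hr2 : r ≤ 2 * (m + 1))
    {ω : F} (hω : IsPrimitiveRoot ω (q ^ 2 - 1)) :
    ∃ v w : Fin r → F, (∀ s, v s ≠ 0) ∧
      (∀ s : Fin r, v s ^ (q + 1) = w s * (ω ^ (s : ℕ)) ^ ((2 * τ + 1) * (2 * m + 1))) ∧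
      ∀ t < m, ∑ s : Fin r, w s * (ω ^ (s : ℕ)) ^ ((2 * τ + 1) * B * (3 + 2 * t)) = 0 := by
  have hBτ : 2 * τ ≤ B := by nlinarith
  obtain ⟨N, hN⟩ : ∃ N, N = (2 * τ + 1) * B := ⟨_, rfl⟩
  have hN0 : 0 < N := by rw [hN]; apply Nat.mul_pos <;> omega
  have hcard : q ^ 2 - 1 = 4 * (m + 1) * N := by
    rw [Nat.sub_eq_iff_eq_add (Nat.one_le_pow _ _ (by omega)), hq, hN]
    linear_combination (4 * B) * hB
  have hω0 : ω ≠ 0 := hω.ne_zero (by rw [hcard]; positivity)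
  have hω1 : ω ^ (4 * (m + 1) * N) = 1 := by rw [← hcard, hω.pow_eq_one]
  obtain ⟨D, rfl⟩ : ∃ D, r = D + (m + 1) := ⟨r - (m + 1), by omega⟩
  obtain ⟨W, κ, hW0, hWκ, hW⟩ := exists_lagrange_weights (D := D) hsub
    (x := fun s : Fin (D + (m + 1)) ↦ ω ^ (2 * N * s)) (y := ω ^ (2 * B))
    (fun s t hst ↦ by
      have hlt : ∀ s : Fin (D + (m + 1)), 2 * N * s < q ^ 2 - 1 := fun s ↦ by
        have := s.2
        rw [hcard]
        nlinarith
      exact Fin.ext (Nat.eq_of_mul_eq_mul_left (by omega)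
        (hω.pow_inj (hlt s) (hlt t) hst)))
    (fun s ↦ by
      rw [← pow_mul, show 2 * N * s * (q + 1) = 4 * (m + 1) * N * ((2 * τ + 1) * s) by
        rw [hq]; linear_combination (4 * N * s) * hB, pow_mul, hω1, one_pow])
    (by
      rw [← pow_mul, show 2 * B * (q + 1) = 4 * (m + 1) * N by
        rw [hq, hN]; linear_combination (4 * B) * hB, hω1])
    (fun s hs ↦ by
      have h1 : (ω ^ (2 * B)) ^ (2 * (m + 1)) = 1 := by
        rw [← hs, ← pow_mul, show 2 * N * s * (2 * (m + 1)) = 4 * (m + 1) * N * s by ring,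
          pow_mul, hω1, one_pow]
      rw [← pow_mul, hω.pow_eq_one_iff_dvd, hcard] at h1
      have := Nat.le_of_dvd (by apply Nat.mul_pos <;> omega) h1
      have h2 : 0 < (m + 1) * B := by apply Nat.mul_pos <;> omega
      rw [hN] at this
      nlinarith)
  have hfrob : ∀ s : Fin (D + (m + 1)),
      (W s * ω ^ (((2 * τ + 1) * (2 * m + 1) + (4 * m + 1) * N) * s)) ^ q
        = κ * (W s * ω ^ (((2 * τ + 1) * (2 * m + 1) + (4 * m + 1) * N) * s)) := by
    intro s
    have hx0 : ω ^ (2 * N * s) ≠ 0 := pow_ne_zero _ hω0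
    have h1 : W s ^ q * (ω ^ (2 * N * s)) ^ 2 = κ * W s * (ω ^ (2 * N * s)) ^ (m + 1) := by
      refine mul_right_cancel₀ (pow_ne_zero D hx0) ?_
      linear_combination hWκ s
    obtain ⟨c, hc⟩ : ∃ c, 2 * B = 3 * τ + c := ⟨2 * B - 3 * τ, by omega⟩
    have h2 : (ω ^ (((2 * τ + 1) * (2 * m + 1) + (4 * m + 1) * N) * s)) ^ q *
        (ω ^ (2 * N * s)) ^ (m + 1) =
        ω ^ (((2 * τ + 1) * (2 * m + 1) + (4 * m + 1) * N) * s) * (ω ^ (2 * N * s)) ^ 2 := by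
      rw [← pow_mul, ← pow_mul, ← pow_mul, ← pow_add, ← pow_add]
      have : ((2 * τ + 1) * (2 * m + 1) + (4 * m + 1) * N) * s * q + 2 * N * s * (m + 1)
          = ((2 * τ + 1) * (2 * m + 1) + (4 * m + 1) * N) * s + 2 * N * s * 2
            + 4 * (m + 1) * N * (c * s) := by
        rw [hq]
        zify at hN hB hc ⊢
        linear_combination (-2 * s * (2 * m + 1) : ℤ) * hN - (6 * s * N : ℤ) * hB +
          (4 * (m + 1) * N * s : ℤ) * hc
      rw [this, pow_add, pow_mul ω (4 * (m + 1) * N), hω1, one_pow, mul_one]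
    refine mul_right_cancel₀ (pow_ne_zero 2 hx0) ?_
    rw [mul_pow]
    linear_combination (ω ^ (((2 * τ + 1) * (2 * m + 1) + (4 * m + 1) * N) * s)) ^ q * h1 +
      κ * W s * h2
  set z : Fin (D + (m + 1)) → F :=
    fun s ↦ W s * ω ^ (((2 * τ + 1) * (2 * m + 1) + (4 * m + 1) * N) * s) with hz
  have hz0 : ∀ s, z s ≠ 0 := fun s ↦ mul_ne_zero (hW0 s) (pow_ne_zero _ hω0)
  have hκ : κ ≠ 0 := by
    rintro rfl
    exact pow_ne_zero q (hz0 ⟨0, by omega⟩) (by rw [hfrob ⟨0, by omega⟩, zero_mul])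
  obtain ⟨z₀, hz₀, hz₀κ⟩ : ∃ z₀ : F, z₀ ≠ 0 ∧ z₀ ^ q = κ * z₀ :=
    ⟨z ⟨0, by omega⟩, hz0 _, hfrob _⟩
  have hv : ∀ s, ∃ v : F, v ^ (q + 1) = z s / z₀ := fun s ↦
    exists_pow_succ_eq_of_pow_eq_self (by omega) hω (div_ne_zero (hz0 s) hz₀)
      (by rw [div_pow, hfrob s, hz₀κ, mul_div_mul_left _ _ hκ])
  choose v hv using hv
  refine ⟨v, fun s ↦ W s * ω ^ ((4 * m + 1) * N * s) / z₀, fun s h ↦ ?_, fun s ↦ ?_,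
    fun t ht ↦ ?_⟩
  · have := hv s
    rw [h, zero_pow (by omega)] at this
    exact div_ne_zero (hz0 s) hz₀ this.symm
  · rw [hv s, hz]
    ring
  · have := hW t (by omega)
    rw [← mul_zero z₀⁻¹, ← this, mul_sum]
    refine sum_congr rfl fun s _ ↦ ?_
    have h1 : ω ^ ((4 * m + 1) * N * s) * (ω ^ (s : ℕ)) ^ ((2 * τ + 1) * B * (3 + 2 * t))
        = (ω ^ (2 * N * s)) ^ t := by
      rw [← hN, ← pow_mul, ← pow_mul, ← pow_add,
        show (4 * m + 1) * N * s + s * (N * (3 + 2 * t))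
          = 4 * (m + 1) * N * s + 2 * N * s * t by ring, pow_add, pow_mul ω (4 * (m + 1) * N),
        hω1, one_pow, one_mul]
    rw [← h1]
    ring

theorem sum_pow_mul_eq_zero_of_not_dvd {F : Type*} [Field F] {ω : F} {l N E : ℕ}
    (hl : 0 < l) (hω : IsPrimitiveRoot ω (l * N)) (hE : ¬N ∣ E) :
    ∑ t : Fin N, (ω ^ (l * (t : ℕ))) ^ E = 0 := by
  have h1 : ω ^ (l * E) ≠ 1 := by
    rwa [Ne, hω.pow_eq_one_iff_dvd, Nat.mul_dvd_mul_iff_left hl]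
  have h2 := geom_sum_mul (ω ^ (l * E)) N
  rw [← pow_mul, mul_right_comm, pow_mul ω (l * N), hω.pow_eq_one, one_pow, sub_self] at h2
  rw [← (mul_eq_zero.1 h2).resolve_right (sub_ne_zero.2 h1), sum_range]
  refine sum_congr rfl fun t _ ↦ ?_
  rw [← pow_mul, ← pow_mul]
  congr 1
  ring



theorem thm_qplus_len_no_plus_one_case1
    (q h τ r n : ℕ) (hq : IsPrimePow q) (hqo : Odd q)
    (hh : 0 < h) (hhe : Even h) (hτ : 1 ≤ τ)
    (hdiv : q + 1 = h * (2 * τ + 1))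
    (hr1 : h ≤ 2 * r) (hr2 : r ≤ h)  -- i.e. h/2 ≤ r ≤ h
    -- n = r(q²-1)/(2h)
    (hn : 2 * h * n = r * (q ^ 2 - 1))
    (k : ℕ) (hk1 : 1 ≤ k)
    -- k ≤ (h+1)(q+1)/(2h) - 3/2
    (hk : 2 * h * k + 3 * h ≤ (h + 1) * (q + 1))
    (F : Type*) [Field F] [Fintype F] (hF : Fintype.card F = q ^ 2) :
    ∃ a v : Fin n → F, Function.Injective a ∧ (∀ l, v l ≠ 0) ∧
      ∀ i j : ℕ, i < k → j < k →
        ∑ l, v l ^ (q + 1) * a l ^ (q * i + j) = 0 := by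
  obtain ⟨H, rfl⟩ := hhe.two_dvd
  obtain ⟨m, rfl⟩ : ∃ m, H = m + 1 := ⟨H - 1, by omega⟩
  obtain ⟨B, hqB⟩ := hqo
  have hB : B + 1 = (m + 1) * (2 * τ + 1) := by
    have : 2 * (B + 1) = 2 * ((m + 1) * (2 * τ + 1)) := by rw [← mul_assoc, ← hdiv, hqB]; ring
    omega
  have hBτ : 2 * τ ≤ B := by nlinarith
  obtain ⟨N, hN⟩ : ∃ N, N = (2 * τ + 1) * B := ⟨_, rfl⟩
  have hcard : q ^ 2 - 1 = 4 * (m + 1) * N := by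
    rw [Nat.sub_eq_iff_eq_add (Nat.one_le_pow _ _ (by omega)), hqB, hN]
    linear_combination (4 * B) * hB
  have hkB : k ≤ B + τ := by
    have h1 : 2 * (m + 1) * (2 * k + 3) ≤ 2 * (m + 1) * ((2 * m + 3) * (2 * τ + 1)) := by
      rw [hdiv] at hk
      linarith
    have h2 := Nat.le_of_mul_le_mul_left h1 (by omega)
    nlinarith
  obtain rfl : n = r * N := by
    refine Nat.eq_of_mul_eq_mul_left (show 0 < 4 * (m + 1) by omega) ?_
    rw [hcard] at hn
    linarith
  obtain ⟨ω, hω⟩ := exists_isPrimitiveRoot_card_sub_one F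
  rw [hF] at hω
  have hω0 : ω ≠ 0 := by
    refine hω.ne_zero ?_
    rw [hcard, hN]
    exact (Nat.mul_pos (by omega) (Nat.mul_pos (by omega) (by omega))).ne'
  obtain ⟨v, w, hv0, hvw, hw⟩ := exists_coset_weights
    (sub_pow_of_card_eq_sq hq hF) hqB hB hτ (by omega) hr2 hω
  refine ⟨fun l ↦ ω ^ ((finProdFinEquiv.symm l).1 + 4 * (m + 1) * ((finProdFinEquiv.symm l).2 : ℕ)),
    fun l ↦ v (finProdFinEquiv.symm l).1 * ω ^ (2 * (2 * m + 1) * ((finProdFinEquiv.symm l).2 : ℕ)),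
    fun l l' hll ↦ ?_, fun l ↦ mul_ne_zero (hv0 _) (pow_ne_zero _ hω0), fun i j hi hj ↦ ?_⟩
  · refine finProdFinEquiv.symm.injective ?_
    dsimp only at hll
    generalize finProdFinEquiv.symm l = x at hll
    generalize finProdFinEquiv.symm l' = y at hll
    have hlt : ∀ x : Fin r × Fin N, (x.1 : ℕ) + 4 * (m + 1) * x.2 < q ^ 2 - 1 := fun x ↦ by
      have h1 := x.1.2
      have h2 := x.2.2
      rw [hcard]
      nlinarith
    have h1 := hω.pow_inj (hlt x) (hlt y) hll
    have hmod : ∀ x : Fin r × Fin N, ((x.1 : ℕ) + 4 * (m + 1) * x.2) % (4 * (m + 1)) = x.1 :=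
      fun x ↦ by
        rw [Nat.add_mul_mod_self_left, Nat.mod_eq_of_lt]
        have := x.1.2
        omega
    have h2 : (x.1 : ℕ) = y.1 := by rw [← hmod x, h1, hmod y]
    rw [h2, Nat.add_left_cancel_iff] at h1
    exact Prod.ext (Fin.ext h2) (Fin.ext (Nat.eq_of_mul_eq_mul_left (by omega) h1))
  · rw [finProdFinEquiv.symm.sum_comp (fun x : Fin r × Fin N ↦
      (v x.1 * ω ^ (2 * (2 * m + 1) * (x.2 : ℕ))) ^ (q + 1) *
        (ω ^ ((x.1 : ℕ) + 4 * (m + 1) * x.2)) ^ (q * i + j))]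
    obtain ⟨E, hE⟩ : ∃ E, E = (2 * B + 1) * i + j + (2 * B + 1 - 2 * τ) := ⟨_, rfl⟩
    have hE' : E = q * i + j + (2 * τ + 1) * (2 * m + 1) := by
      have : 2 * B + 1 - 2 * τ = (2 * τ + 1) * (2 * m + 1) := by
        rw [Nat.sub_eq_iff_eq_add (by omega)]
        linarith
      rw [hE, this, hqB]
    have hterm : ∀ x : Fin r × Fin N, (v x.1 * ω ^ (2 * (2 * m + 1) * (x.2 : ℕ))) ^ (q + 1) *
        (ω ^ ((x.1 : ℕ) + 4 * (m + 1) * x.2)) ^ (q * i + j)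
        = (w x.1 * (ω ^ (x.1 : ℕ)) ^ E) * (ω ^ (4 * (m + 1) * (x.2 : ℕ))) ^ E := fun x ↦ by
      have h1 : (ω ^ (2 * (2 * m + 1) * (x.2 : ℕ))) ^ (q + 1)
          = (ω ^ (4 * (m + 1) * (x.2 : ℕ))) ^ ((2 * τ + 1) * (2 * m + 1)) := by
        rw [hdiv, ← pow_mul, ← pow_mul]
        congr 1
        ring
      rw [mul_pow, hvw, h1, hE', pow_add ω, mul_pow, pow_add, pow_add]
      ring
    rw [sum_congr rfl fun x _ ↦ hterm x, Fintype.sum_prod_type]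
    simp_rw [← mul_sum]
    rw [← sum_mul]
    by_cases hdvd : N ∣ E
    · rw [hN, hE] at hdvd
      obtain ⟨t, ht, hEt⟩ := exists_odd_multiple_of_dvd hτ hB hkB hi hj hdvd
      rw [← hE] at hEt
      rw [hEt, hw t (by omega), zero_mul]
    · rw [sum_pow_mul_eq_zero_of_not_dvd (by omega) (hcard ▸ hω) hdvd, mul_zero]
end
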